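/- Let n ≥ 2 and let G be a finite group acting on ℝⁿ by orientation-preserving orthogonal linear transformations (i.e., G a finite subgroup of O(n) all of whose elements have determinant 1). Let Y denote the quotient space (D^n/G)/(S^{n-1}/G) of the orbit space of the closed unit disk obtained by collapsing the orbit space of the boundary sphere to a point. Then the singular homology H_p(Y; ℚ) is isomorphic to ℚ for p = 0 and p = n, and vanishes for all other p. -/

import Mathlib

open CategoryTheory

noncomputable section

/-- The singular chain complex of a topological space with rational coefficients:
the alternating face map complex of the free simplicial `ℚ`-module on the singular
simplicial set. -/
def singularChainComplexQ (X : TopCat) : ChainComplex (ModuleCat ℚ) ℕ :=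
  (AlgebraicTopology.alternatingFaceMapComplex (ModuleCat ℚ)).obj
    (((SimplicialObject.whiskering _ _).obj (ModuleCat.free ℚ)).obj (TopCat.toSSet.obj X))

/-- The `p`-th singular homology of a topological space, with rational coefficients. -/
def singularHomologyQ (X : TopCat) (p : ℕ) : ModuleCat ℚ :=
  (singularChainComplexQ X).homology p

/-- The orbit equivalence relation on the closed unit disk `D^n ⊆ ℝⁿ` for the action of a
subgroup `G` of the group of linear isometries of `ℝⁿ`. -/
def diskOrbitSetoid (n : ℕ)
    (G : Subgroup (EuclideanSpace ℝ (Fin n) ≃ₗᵢ[ℝ] EuclideanSpace ℝ (Fin n))) :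
    Setoid (Metric.closedBall (0 : EuclideanSpace ℝ (Fin n)) 1) where
  r x y := ∃ g ∈ G, g x.1 = y.1
  iseqv := by
    constructor
    · intro x
      exact ⟨1, G.one_mem, by simp [LinearIsometryEquiv.coe_one]⟩
    · rintro x y ⟨g, hg, h⟩
      exact ⟨g⁻¹, G.inv_mem hg, by
        rw [← h, LinearIsometryEquiv.coe_inv]
        exact g.symm_apply_apply x.1⟩
    · rintro x y z ⟨g, hg, hxy⟩ ⟨h, hh, hyz⟩
      exact ⟨h * g, G.mul_mem hh hg, by
        rw [← hyz, ← hxy, LinearIsometryEquiv.coe_mul]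
        rfl⟩

/-- The image of the orbit space `S^{n-1}/G` of the boundary sphere inside the orbit space
`D^n/G` of the closed unit disk. -/
def sphereOrbitImage (n : ℕ)
    (G : Subgroup (EuclideanSpace ℝ (Fin n) ≃ₗᵢ[ℝ] EuclideanSpace ℝ (Fin n))) :
    Set (Quotient (diskOrbitSetoid n G)) :=
  {q | ∃ x : Metric.closedBall (0 : EuclideanSpace ℝ (Fin n)) 1,
    ‖x.1‖ = 1 ∧ q = Quotient.mk (diskOrbitSetoid n G) x}

/-- The equivalence relation on `D^n/G` collapsing the subspace `S^{n-1}/G` to a point. -/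
def collapseSetoid (n : ℕ)
    (G : Subgroup (EuclideanSpace ℝ (Fin n) ≃ₗᵢ[ℝ] EuclideanSpace ℝ (Fin n))) :
    Setoid (Quotient (diskOrbitSetoid n G)) where
  r a b := a = b ∨ (a ∈ sphereOrbitImage n G ∧ b ∈ sphereOrbitImage n G)
  iseqv := by
    constructor
    · intro a
      exact Or.inl rfl
    · rintro a b (rfl | ⟨ha, hb⟩)
      · exact Or.inl rfl
      · exact Or.inr ⟨hb, ha⟩
    · rintro a b c (rfl | ⟨ha, hb⟩) (rfl | ⟨hb', hc⟩)
      · exact Or.inl rfl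
      · exact Or.inr ⟨hb', hc⟩
      · exact Or.inr ⟨ha, hb⟩
      · exact Or.inr ⟨ha, hc⟩

/-! ### Augmented singular chains -/

/-- The singular simplices of `X`, indexed by their number of vertices; with no vertices there
is exactly one, the empty simplex. -/
abbrev SingSimplex (X : Type*) [TopologicalSpace X] : Type _ :=
  Σ k : ℕ, C(stdSimplex ℝ (Fin k), X)

/-- Augmented singular chains with rational coefficients, all degrees together. -/
abbrev SingChain (X : Type*) [TopologicalSpace X] : Type _ := SingSimplex X →₀ ℚ

/-- The inclusion of the `i`-th face of a standard simplex. -/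
def simplexFace {k : ℕ} (i : Fin (k + 1)) :
    C(stdSimplex ℝ (Fin k), stdSimplex ℝ (Fin (k + 1))) :=
  ⟨stdSimplex.map i.succAbove, stdSimplex.continuous_map _⟩

lemma simplexFace_succAbove {k : ℕ} (i : Fin (k + 1)) (t : stdSimplex ℝ (Fin k)) (j : Fin k) :
    simplexFace i t (i.succAbove j) = t j := by
  change stdSimplex.map i.succAbove t _ = _
  rw [stdSimplex.map_coe, FunOnFinite.linearMap_apply_apply]
  rw [Finset.sum_eq_single j]
  · intro b hb hne
    simp only [Finset.mem_filter, Finset.mem_univ, true_and] at hb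
    exact absurd (Fin.succAbove_right_injective hb) hne
  · simp

lemma simplexFace_self {k : ℕ} (i : Fin (k + 1)) (t : stdSimplex ℝ (Fin k)) :
    simplexFace i t i = 0 := by
  change stdSimplex.map i.succAbove t _ = _
  rw [stdSimplex.map_coe, FunOnFinite.linearMap_apply_apply]
  apply Finset.sum_eq_zero
  intro b hb
  simp only [Finset.mem_filter, Finset.mem_univ, true_and] at hb
  exact absurd hb (Fin.succAbove_ne i b)

instance : IsEmpty (stdSimplex ℝ (Fin 0)) := by
  rw [stdSimplex_of_isEmpty_index]; infer_instance

namespace SingChain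

section Basic

variable {X Y Z : Type*} [TopologicalSpace X] [TopologicalSpace Y] [TopologicalSpace Z]

/-- The chain consisting of a single simplex. -/
abbrev single {k : ℕ} (σ : C(stdSimplex ℝ (Fin k), X)) : SingChain X :=
  Finsupp.single ⟨k, σ⟩ 1

/-- The boundary of a simplex. -/
def bdrySimplex : SingSimplex X → SingChain X
  | ⟨0, _⟩ => 0
  | ⟨k + 1, σ⟩ => ∑ i : Fin (k + 1), (-1 : ℚ) ^ (i : ℕ) • single (σ.comp (simplexFace i))

/-- The augmented singular boundary operator. -/
def bdry : SingChain X →ₗ[ℚ] SingChain X := Finsupp.linearCombination ℚ bdrySimplex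

/-- The chain map induced by a continuous map. -/
def push (f : C(X, Y)) : SingChain X →ₗ[ℚ] SingChain Y :=
  Finsupp.lmapDomain ℚ ℚ (fun σ => ⟨σ.1, f.comp σ.2⟩)

@[simp] lemma push_single (f : C(X, Y)) {k : ℕ} (σ : C(stdSimplex ℝ (Fin k), X)) :
    push f (single σ) = single (f.comp σ) := by
  simp [push, Finsupp.mapDomain_single]

lemma bdry_single_succ {k : ℕ} (σ : C(stdSimplex ℝ (Fin (k + 1)), X)) :
    bdry (single σ) =
      ∑ i : Fin (k + 1), (-1 : ℚ) ^ (i : ℕ) • single (σ.comp (simplexFace i)) := by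
  simp [bdry, bdrySimplex]

@[simp] lemma bdry_single_zero (σ : C(stdSimplex ℝ (Fin 0), X)) : bdry (single σ) = 0 := by
  simp [bdry, bdrySimplex]

lemma hom_ext {M : Type*} [AddCommGroup M] [Module ℚ M] {f g : SingChain X →ₗ[ℚ] M}
    (h : ∀ (k : ℕ) (σ : C(stdSimplex ℝ (Fin k), X)), f (single σ) = g (single σ)) : f = g :=
  Finsupp.lhom_ext' fun ⟨k, σ⟩ => LinearMap.ext_ring (h k σ)

lemma push_comp (g : C(Y, Z)) (f : C(X, Y)) (c : SingChain X) :
    push (g.comp f) c = push g (push f c) := by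
  suffices push (g.comp f) = push g ∘ₗ push f by rw [this]; rfl
  refine hom_ext fun k σ => ?_
  rw [LinearMap.comp_apply, push_single, push_single, push_single]; rfl

lemma push_id (c : SingChain X) : push (ContinuousMap.id X) c = c := by
  suffices push (ContinuousMap.id X) = LinearMap.id by rw [this]; rfl
  refine hom_ext fun k σ => ?_
  rw [push_single]; rfl

lemma bdry_push (f : C(X, Y)) (c : SingChain X) : bdry (push f c) = push f (bdry c) := by
  suffices bdry ∘ₗ push f = push f ∘ₗ bdry from LinearMap.congr_fun this c
  refine hom_ext fun k σ => ?_
  rw [LinearMap.comp_apply, LinearMap.comp_apply, push_single]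
  cases k with
  | zero => simp
  | succ k => simp only [bdry_single_succ, map_sum, map_smul, push_single]; rfl

/-- The chains all of whose simplices lie in `U`. -/
def within (U : Set X) : Submodule ℚ (SingChain X) :=
  Finsupp.supported ℚ ℚ {σ : SingSimplex X | Set.range σ.2 ⊆ U}

/-- The chains all of whose simplices have `k` vertices. -/
def ofDegree (X : Type*) [TopologicalSpace X] (k : ℕ) : Submodule ℚ (SingChain X) :=
  Finsupp.supported ℚ ℚ {σ : SingSimplex X | σ.1 = k}

lemma within_induction {U : Set X} {p : SingChain X → Prop} {c : SingChain X} (hc : c ∈ within U)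
    (single : ∀ (k : ℕ) (σ : C(stdSimplex ℝ (Fin k), X)), Set.range σ ⊆ U → p (single σ))
    (zero : p 0) (add : ∀ a b, p a → p b → p (a + b)) (smul : ∀ (r : ℚ) a, p a → p (r • a)) :
    p c := by
  rw [within, Finsupp.supported_eq_span_single] at hc
  induction hc using Submodule.span_induction with
  | mem x hx => obtain ⟨⟨k, σ⟩, h, rfl⟩ := hx; exact single k σ h
  | zero => exact zero
  | add a b _ _ ha hb => exact add a b ha hb
  | smul r a _ ha => exact smul r a ha

lemma single_mem_within {U : Set X} {k : ℕ} {σ : C(stdSimplex ℝ (Fin k), X)}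
    (h : Set.range σ ⊆ U) : single σ ∈ within U :=
  Finsupp.single_mem_supported ℚ _ h

lemma eqOn_within {M : Type*} [AddCommGroup M] [Module ℚ M] {f g : SingChain X →ₗ[ℚ] M}
    {U : Set X} (h : ∀ (k : ℕ) (σ : C(stdSimplex ℝ (Fin k), X)), Set.range σ ⊆ U →
      f (single σ) = g (single σ)) {c : SingChain X} (hc : c ∈ within U) : f c = g c := by
  refine within_induction (p := fun c => f c = g c) hc h (by simp) ?_ ?_
  · intro a b ha hb; simp [ha, hb]
  · intro r a ha; simp [ha]

lemma map_mem_of_single {M : Type*} [AddCommGroup M] [Module ℚ M] {f : SingChain X →ₗ[ℚ] M}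
    {N : Submodule ℚ M} {U : Set X} (h : ∀ (k : ℕ) (σ : C(stdSimplex ℝ (Fin k), X)),
      Set.range σ ⊆ U → f (single σ) ∈ N) {c : SingChain X} (hc : c ∈ within U) : f c ∈ N := by
  refine within_induction (p := fun c => f c ∈ N) hc h (by simp) ?_ ?_
  · intro a b ha hb; rw [map_add]; exact N.add_mem ha hb
  · intro r a ha; rw [map_smul]; exact N.smul_mem _ ha

lemma within_mono {U V : Set X} (h : U ⊆ V) : within U ≤ within V :=
  Finsupp.supported_mono fun _ hσ => subset_trans hσ h

lemma within_inter (U V : Set X) : within (U ∩ V) = within U ⊓ within V := by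
  rw [within, within, within, ← Finsupp.supported_inter]
  congr 1; ext σ; simp [Set.subset_inter_iff]

lemma mem_within_univ (c : SingChain X) : c ∈ within (Set.univ : Set X) := by
  simp [within]

lemma push_mem_within {f : C(X, Y)} {U : Set X} {V : Set Y} (h : Set.MapsTo f U V)
    {c : SingChain X} (hc : c ∈ within U) : push f c ∈ within V :=
  map_mem_of_single (fun k σ hσ => by
    rw [push_single]
    apply single_mem_within
    rintro _ ⟨t, rfl⟩
    exact h (hσ ⟨t, rfl⟩)) hc

lemma bdry_mem_within {U : Set X} {c : SingChain X} (hc : c ∈ within U) : bdry c ∈ within U :=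
  map_mem_of_single (fun k σ hσ => by
    cases k with
    | zero => simp
    | succ k =>
      rw [bdry_single_succ]
      refine Submodule.sum_mem _ fun i _ => Submodule.smul_mem _ _ (single_mem_within ?_)
      rintro _ ⟨t, rfl⟩
      exact hσ ⟨_, rfl⟩) hc

/-- The component of a chain in the degree of simplices with `k` vertices. -/
def component (k : ℕ) : SingChain X →ₗ[ℚ] SingChain X :=
  Finsupp.linearCombination ℚ fun σ => if σ.1 = k then Finsupp.single σ 1 else 0

lemma component_single {k j : ℕ} (σ : C(stdSimplex ℝ (Fin k), X)) :
    component j (single σ) = if k = j then single σ else 0 := by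
  simp [component]

lemma component_mem_ofDegree (k : ℕ) (c : SingChain X) : component k c ∈ ofDegree X k :=
  map_mem_of_single (U := Set.univ) (fun j σ _ => by
    rw [component_single]
    split_ifs with h
    · exact Finsupp.single_mem_supported ℚ _ h
    · exact Submodule.zero_mem _) (mem_within_univ c)

lemma component_mem_within (k : ℕ) {U : Set X} {c : SingChain X} (hc : c ∈ within U) :
    component k c ∈ within U :=
  map_mem_of_single (fun j σ h => by
    rw [component_single]
    split_ifs
    · exact single_mem_within h
    · exact Submodule.zero_mem _) hc

lemma component_of_mem {k : ℕ} {c : SingChain X} (hc : c ∈ ofDegree X k) : component k c = c := by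
  rw [ofDegree, Finsupp.supported_eq_span_single] at hc
  induction hc using Submodule.span_induction with
  | mem x hx => obtain ⟨⟨k, σ⟩, h, rfl⟩ := hx; rw [component_single]; exact if_pos h
  | zero => simp
  | add a b _ _ ha hb => simp [ha, hb]
  | smul r a _ ha => simp [ha]

lemma bdry_component_succ (k : ℕ) (c : SingChain X) :
    bdry (component (k + 1) c) = component k (bdry c) := by
  suffices bdry ∘ₗ component (k + 1) = component k ∘ₗ bdry from LinearMap.congr_fun this c
  refine hom_ext fun j σ => ?_
  rw [LinearMap.comp_apply, LinearMap.comp_apply, component_single]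
  cases j with
  | zero => simp
  | succ j =>
    rw [bdry_single_succ, map_sum]
    simp only [map_smul, component_single, Nat.add_right_cancel_iff]
    split_ifs with h
    · rw [bdry_single_succ]
    · simp

lemma bdry_component_zero (c : SingChain X) : bdry (component 0 c) = 0 := by
  suffices bdry ∘ₗ component 0 = (0 : SingChain X →ₗ[ℚ] SingChain X) from
    LinearMap.congr_fun this c
  refine hom_ext fun j σ => ?_
  rw [LinearMap.comp_apply, component_single]
  cases j <;> simp

lemma push_component (f : C(X, Y)) (k : ℕ) (c : SingChain X) :
    push f (component k c) = component k (push f c) := by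
  suffices push f ∘ₗ component k = component k ∘ₗ push f from LinearMap.congr_fun this c
  refine hom_ext fun j σ => ?_
  rw [LinearMap.comp_apply, LinearMap.comp_apply, component_single, push_single, component_single]
  split_ifs <;> simp

lemma bdry_mem_ofDegree {k : ℕ} {c : SingChain X} (hc : c ∈ ofDegree X (k + 1)) :
    bdry c ∈ ofDegree X k := by
  rw [← component_of_mem hc, bdry_component_succ]
  exact component_mem_ofDegree _ _

/-- The chain consisting of the empty simplex. -/
def empty (X : Type*) [TopologicalSpace X] : SingChain X :=
  single (k := 0) ⟨isEmptyElim, continuous_of_discreteTopology⟩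

lemma single_zero_eq (σ : C(stdSimplex ℝ (Fin 0), X)) : single σ = empty X := by
  rw [empty]; congr 2; ext t; exact isEmptyElim t

lemma empty_mem_within (U : Set X) : empty X ∈ within U :=
  single_mem_within (by rintro _ ⟨t, -⟩; exact isEmptyElim t)

@[simp] lemma bdry_empty : bdry (empty X) = 0 := bdry_single_zero _

@[simp] lemma push_empty (f : C(X, Y)) : push f (empty X) = empty Y := by
  rw [empty, push_single, single_zero_eq]

/-- The chain consisting of the simplex with one vertex at `x`. -/
abbrev point (x : X) : SingChain X := single (k := 1) (ContinuousMap.const _ x)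

@[simp] lemma bdry_point (x : X) : bdry (point x) = empty X := by
  rw [point, bdry_single_succ]
  simp [single_zero_eq]

lemma bdry_single_one (σ : C(stdSimplex ℝ (Fin 1), X)) : bdry (single σ) = empty X := by
  rw [bdry_single_succ]
  simp [single_zero_eq]

lemma point_mem_within {U : Set X} {x : X} (h : x ∈ U) : point x ∈ within U :=
  single_mem_within (by rintro _ ⟨t, rfl⟩; exact h)

@[simp] lemma push_point (f : C(X, Y)) (x : X) : push f (point x) = point (f x) := by
  rw [point, push_single]; rfl

/-- The coefficient of the empty simplex in a chain. -/
def emptyCoeff : SingChain X →ₗ[ℚ] ℚ :=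
  Finsupp.linearCombination ℚ fun σ => if σ.1 = 0 then 1 else 0

lemma emptyCoeff_single {k : ℕ} (σ : C(stdSimplex ℝ (Fin k), X)) :
    emptyCoeff (single σ) = if k = 0 then 1 else 0 := by
  simp [emptyCoeff]

@[simp] lemma emptyCoeff_empty : emptyCoeff (empty X) = 1 := by simp [empty, emptyCoeff_single]

end Basic

end SingChain

/-! ### Cones over singular simplices -/

/-- The map exhibiting a standard simplex as the cone over its face opposite to the vertex `0`. -/
def coneMap (k : ℕ) :
    C(unitInterval × stdSimplex ℝ (Fin k), stdSimplex ℝ (Fin (k + 1))) where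
  toFun p := ⟨Fin.cons (p.1 : ℝ) fun i => (1 - (p.1 : ℝ)) * p.2 i, by
    constructor
    · refine Fin.cases p.1.2.1 fun i => ?_
      exact mul_nonneg (sub_nonneg.2 p.1.2.2) (p.2.2.1 i)
    · rw [Fin.sum_univ_succ]
      simp only [Fin.cons_zero, Fin.cons_succ, ← Finset.mul_sum, stdSimplex.sum_eq_one]
      ring⟩
  continuous_toFun := by
    refine Continuous.subtype_mk (continuous_pi fun i => Fin.cases ?_ (fun i => ?_) i) _
    · simpa using by fun_prop
    · simp only [Fin.cons_succ]
      have h : Continuous fun p : unitInterval × stdSimplex ℝ (Fin k) => p.2 i :=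
        (continuous_apply i).comp (continuous_subtype_val.comp continuous_snd)
      fun_prop

lemma coneMap_zero {k : ℕ} (p : unitInterval × stdSimplex ℝ (Fin k)) :
    coneMap k p 0 = p.1 := rfl

lemma coneMap_succ {k : ℕ} (p : unitInterval × stdSimplex ℝ (Fin k)) (i : Fin k) :
    coneMap k p i.succ = (1 - (p.1 : ℝ)) * p.2 i := rfl

lemma coneMap_surjective (k : ℕ) : Function.Surjective (coneMap (k + 1)) := by
  intro u
  have hs : u 0 + ∑ i : Fin (k + 1), u i.succ = 1 := by
    rw [← Fin.sum_univ_succ, stdSimplex.sum_eq_one]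
  by_cases h : u 0 = 1
  · refine ⟨(1, stdSimplex.vertex 0), stdSimplex.ext (funext fun i => Fin.cases ?_ (fun i => ?_) i)⟩
    · rw [coneMap_zero, h]; rfl
    · rw [coneMap_succ]
      have h0 : ∑ i : Fin (k + 1), u i.succ = 0 := by linarith
      rw [Finset.sum_eq_zero_iff_of_nonneg fun i _ => stdSimplex.zero_le u _] at h0
      simp [h0 i (Finset.mem_univ i)]
  · have h1 : 0 < 1 - u 0 := by
      have := stdSimplex.le_one u 0
      exact sub_pos.2 (lt_of_le_of_ne this h)
    refine ⟨(⟨u 0, u.2.1 0, stdSimplex.le_one u 0⟩,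
      ⟨fun i => u i.succ / (1 - u 0), fun i => div_nonneg (u.2.1 _) h1.le, ?_⟩),
      stdSimplex.ext (funext fun i => Fin.cases ?_ (fun i => ?_) i)⟩
    · rw [← Finset.sum_div, div_eq_one_iff_eq h1.ne']; linarith
    · rfl
    · rw [coneMap_succ]
      exact mul_div_cancel₀ _ h1.ne'

lemma isQuotientMap_coneMap (k : ℕ) : Topology.IsQuotientMap (coneMap (k + 1)) :=
  (coneMap (k + 1)).continuous.isClosedMap.isQuotientMap (coneMap _).continuous
    (coneMap_surjective k)

lemma simplexFace_zero_eq_coneMap {k : ℕ} (t : stdSimplex ℝ (Fin k)) :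
    simplexFace 0 t = coneMap k (0, t) := by
  refine stdSimplex.ext (funext fun i => Fin.cases ?_ (fun i => ?_) i)
  · rw [simplexFace_self, coneMap_zero]; rfl
  · rw [coneMap_succ]
    have := simplexFace_succAbove 0 t i
    rw [Fin.zero_succAbove] at this
    rw [this]; simp

lemma simplexFace_succ_coneMap {k : ℕ} (i : Fin (k + 1)) (s : unitInterval)
    (t : stdSimplex ℝ (Fin k)) :
    simplexFace i.succ (coneMap k (s, t)) = coneMap (k + 1) (s, simplexFace i t) := by
  refine stdSimplex.ext (funext fun j => Fin.succAboveCases i.succ ?_ (fun j => ?_) j)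
  · rw [simplexFace_self, coneMap_succ]
    simp [simplexFace_self]
  · rw [simplexFace_succAbove]
    refine Fin.cases ?_ (fun j => ?_) j
    · rw [Fin.succ_succAbove_zero]; rfl
    · rw [Fin.succ_succAbove_succ, coneMap_succ, coneMap_succ]
      simp [simplexFace_succAbove]

/-- A deformation of `U` inside itself whose final map is locally constant. -/
structure LocalContraction {X : Type*} [TopologicalSpace X] (U : Set X) where
  /-- The deformation. -/
  H : unitInterval → X → X
  continuousOn : ContinuousOn (fun p : unitInterval × X => H p.1 p.2) (Set.univ ×ˢ U)
  zero : ∀ x ∈ U, H 0 x = x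
  mem : ∀ s, ∀ x ∈ U, H s x ∈ U
  locallyConstant : ∀ x ∈ U, ∀ᶠ y in nhdsWithin x U, H 1 y = H 1 x

namespace LocalContraction

open SingChain

variable {X : Type*} [TopologicalSpace X] {U : Set X} (L : LocalContraction U)
include L

lemma end_eq {k : ℕ} {σ : C(stdSimplex ℝ (Fin (k + 1)), X)} (hσ : Set.range σ ⊆ U)
    (t t' : stdSimplex ℝ (Fin (k + 1))) : L.H 1 (σ t) = L.H 1 (σ t') := by
  have h : IsLocallyConstant fun t => L.H 1 (σ t) := by
    rw [IsLocallyConstant.iff_eventually_eq]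
    intro t
    have h1 := L.locallyConstant (σ t) (hσ ⟨t, rfl⟩)
    have h2 : Filter.Tendsto σ (nhds t) (nhdsWithin (σ t) U) :=
      tendsto_nhdsWithin_iff.2 ⟨σ.continuous.continuousAt,
        Filter.Eventually.of_forall fun t => hσ ⟨t, rfl⟩⟩
    exact h2.eventually h1
  exact h.apply_eq_of_isPreconnected isPreconnected_univ (Set.mem_univ _) (Set.mem_univ _)

/-- The deformation of a simplex along a contraction. -/
def deform {k : ℕ} (σ : C(stdSimplex ℝ (Fin k), X)) (hσ : Set.range σ ⊆ U) :
    C(unitInterval × stdSimplex ℝ (Fin k), X) where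
  toFun p := L.H p.1 (σ p.2)
  continuous_toFun := by
    have h : Continuous fun p : unitInterval × stdSimplex ℝ (Fin k) => (p.1, σ p.2) := by
      fun_prop
    exact L.continuousOn.comp_continuous h fun p => ⟨trivial, hσ ⟨_, rfl⟩⟩

lemma deform_factorsThrough {k : ℕ} (σ : C(stdSimplex ℝ (Fin (k + 1)), X))
    (hσ : Set.range σ ⊆ U) :
    Function.FactorsThrough (L.deform σ hσ) (coneMap (k + 1)) := by
  rintro ⟨s, t⟩ ⟨s', t'⟩ h
  have hs : s = s' := Subtype.ext (congrArg (fun u => u 0) h)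
  subst hs
  change L.H s (σ t) = L.H s (σ t')
  by_cases h1 : s = 1
  · rw [h1]; exact L.end_eq hσ t t'
  · have h2 : (1 - (s : ℝ)) ≠ 0 := fun h => h1 (Subtype.ext (sub_eq_zero.1 h).symm)
    have : t = t' := stdSimplex.ext (funext fun i => by
      have := congrArg (fun u => u i.succ) h
      exact mul_left_cancel₀ h2 this)
    rw [this]

/-- The cone over a simplex along a contraction. -/
def coneSimplex {k : ℕ} (σ : C(stdSimplex ℝ (Fin (k + 1)), X)) (hσ : Set.range σ ⊆ U) :
    C(stdSimplex ℝ (Fin (k + 2)), X) :=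
  (isQuotientMap_coneMap k).lift (L.deform σ hσ) (L.deform_factorsThrough σ hσ)

lemma coneSimplex_coneMap {k : ℕ} (σ : C(stdSimplex ℝ (Fin (k + 1)), X))
    (hσ : Set.range σ ⊆ U) (s : unitInterval) (t : stdSimplex ℝ (Fin (k + 1))) :
    L.coneSimplex σ hσ (coneMap (k + 1) (s, t)) = L.H s (σ t) :=
  DFunLike.congr_fun ((isQuotientMap_coneMap k).lift_comp (L.deform σ hσ)
    (L.deform_factorsThrough σ hσ)) (s, t)

lemma range_coneSimplex_subset {k : ℕ} (σ : C(stdSimplex ℝ (Fin (k + 1)), X))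
    (hσ : Set.range σ ⊆ U) : Set.range (L.coneSimplex σ hσ) ⊆ U := by
  rintro _ ⟨u, rfl⟩
  obtain ⟨⟨s, t⟩, rfl⟩ := coneMap_surjective k u
  rw [coneSimplex_coneMap]
  exact L.mem _ _ (hσ ⟨t, rfl⟩)

open Classical in
/-- The cone operator on single simplices; it vanishes on the empty simplex. -/
def coneOfSimplex : SingSimplex X → SingChain X
  | ⟨0, _⟩ => 0
  | ⟨_ + 1, σ⟩ => if h : Set.range σ ⊆ U then single (L.coneSimplex σ h) else 0

/-- The cone operator of a contraction. -/
def cone : SingChain X →ₗ[ℚ] SingChain X := Finsupp.linearCombination ℚ L.coneOfSimplex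

lemma cone_single_succ {k : ℕ} (σ : C(stdSimplex ℝ (Fin (k + 1)), X)) (h : Set.range σ ⊆ U) :
    L.cone (single σ) = single (L.coneSimplex σ h) := by
  simp [cone, coneOfSimplex, h]

@[simp] lemma cone_single_zero (σ : C(stdSimplex ℝ (Fin 0), X)) : L.cone (single σ) = 0 := by
  simp [cone, coneOfSimplex]

@[simp] lemma cone_empty : L.cone (empty X) = 0 := L.cone_single_zero _

lemma cone_mem_within {c : SingChain X} (hc : c ∈ within U) : L.cone c ∈ within U :=
  map_mem_of_single (fun k σ h => by
    cases k with
    | zero => simp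
    | succ k =>
      rw [L.cone_single_succ σ h]
      exact single_mem_within (L.range_coneSimplex_subset σ h)) hc

lemma push_cone {Y : Type*} [TopologicalSpace Y] {V : Set Y} (M : LocalContraction V)
    {f : C(X, Y)} (hf : Set.MapsTo f U V) (h : ∀ s, ∀ x ∈ U, f (L.H s x) = M.H s (f x))
    {c : SingChain X} (hc : c ∈ within U) : push f (L.cone c) = M.cone (push f c) := by
  refine eqOn_within (f := push f ∘ₗ L.cone) (g := M.cone ∘ₗ push f) (fun k σ hσ => ?_) hc
  rw [LinearMap.comp_apply, LinearMap.comp_apply, push_single]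
  cases k with
  | zero => simp
  | succ k =>
    have hσ' : Set.range (f.comp σ) ⊆ V := by rintro _ ⟨t, rfl⟩; exact hf (hσ ⟨t, rfl⟩)
    rw [L.cone_single_succ σ hσ, M.cone_single_succ _ hσ', push_single]
    congr 2
    ext u
    obtain ⟨⟨s, t⟩, rfl⟩ := coneMap_surjective k u
    rw [ContinuousMap.comp_apply, coneSimplex_coneMap, coneSimplex_coneMap]
    exact h s _ (hσ ⟨t, rfl⟩)

omit L in
lemma range_comp_face_subset {k : ℕ} {σ : C(stdSimplex ℝ (Fin (k + 1)), X)}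
    (h : Set.range σ ⊆ U) (i : Fin (k + 1)) : Set.range (σ.comp (simplexFace i)) ⊆ U := by
  rintro _ ⟨t, rfl⟩; exact h ⟨_, rfl⟩

lemma coneSimplex_comp_face_zero {k : ℕ} (σ : C(stdSimplex ℝ (Fin (k + 1)), X))
    (h : Set.range σ ⊆ U) : (L.coneSimplex σ h).comp (simplexFace 0) = σ := by
  ext t
  rw [ContinuousMap.comp_apply, simplexFace_zero_eq_coneMap, coneSimplex_coneMap]
  exact L.zero _ (h ⟨t, rfl⟩)

lemma coneSimplex_comp_face_succ {k : ℕ} (σ : C(stdSimplex ℝ (Fin (k + 2)), X))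
    (h : Set.range σ ⊆ U) (i : Fin (k + 2)) :
    (L.coneSimplex σ h).comp (simplexFace i.succ) =
      L.coneSimplex (σ.comp (simplexFace i)) (range_comp_face_subset h i) := by
  ext u
  obtain ⟨⟨s, t⟩, rfl⟩ := coneMap_surjective k u
  rw [coneSimplex_coneMap, ContinuousMap.comp_apply, simplexFace_succ_coneMap,
    coneSimplex_coneMap]
  rfl

lemma bdry_cone_single_one (σ : C(stdSimplex ℝ (Fin 1), X)) (h : Set.range σ ⊆ U) :
    bdry (L.cone (single σ)) = single σ - point (L.H 1 (σ default)) := by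
  rw [L.cone_single_succ σ h, bdry_single_succ, Fin.sum_univ_two, coneSimplex_comp_face_zero]
  have : (L.coneSimplex σ h).comp (simplexFace 1) =
      ContinuousMap.const _ (L.H 1 (σ default)) := by
    ext u
    have hu : simplexFace 1 u = coneMap 1 (1, default) := by
      refine stdSimplex.ext (funext fun i => ?_)
      fin_cases i
      · have := simplexFace_succAbove (1 : Fin 2) u 0
        change _ = (1 : ℝ)
        simpa using this
      · have := simplexFace_self (1 : Fin 2) u
        refine this.trans ?_
        change _ = coneMap 1 (1, default) (Fin.succ 0)
        rw [coneMap_succ]; simp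
    rw [ContinuousMap.comp_apply, hu, coneSimplex_coneMap]; rfl
  rw [this]; simp [sub_eq_add_neg]

lemma bdry_cone_single_succ_succ {k : ℕ} (σ : C(stdSimplex ℝ (Fin (k + 2)), X))
    (h : Set.range σ ⊆ U) :
    bdry (L.cone (single σ)) + L.cone (bdry (single σ)) = single σ := by
  rw [L.cone_single_succ σ h, bdry_single_succ, Fin.sum_univ_succ, coneSimplex_comp_face_zero,
    bdry_single_succ σ, map_sum]
  simp only [map_smul, coneSimplex_comp_face_succ]
  have : ∀ i : Fin (k + 2), L.cone (single (σ.comp (simplexFace i))) =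
      single (L.coneSimplex (σ.comp (simplexFace i)) (range_comp_face_subset h i)) :=
    fun i => L.cone_single_succ _ _
  simp only [this, Fin.val_zero, pow_zero, one_smul, Fin.val_succ, pow_succ, mul_neg, mul_one,
    neg_smul, Finset.sum_neg_distrib]
  abel

/-- The augmented cone operator of a contraction to a point `p`, sending the empty simplex to
`p`. -/
def coneTo (p : X) : SingChain X →ₗ[ℚ] SingChain X :=
  L.cone + (LinearMap.toSpanSingleton ℚ _ (point p)).comp emptyCoeff

lemma coneTo_apply (p : X) (c : SingChain X) :
    L.coneTo p c = L.cone c + emptyCoeff c • point p := rfl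

lemma coneTo_mem_within {p : X} (hp : p ∈ U) {c : SingChain X} (hc : c ∈ within U) :
    L.coneTo p c ∈ within U :=
  Submodule.add_mem _ (L.cone_mem_within hc) (Submodule.smul_mem _ _ (point_mem_within hp))

lemma bdry_coneTo {p : X} (hp : ∀ x ∈ U, L.H 1 x = p) {c : SingChain X} (hc : c ∈ within U) :
    bdry (L.coneTo p c) + L.coneTo p (bdry c) = c := by
  refine eqOn_within (f := bdry ∘ₗ L.coneTo p + L.coneTo p ∘ₗ bdry) (g := LinearMap.id)
    (fun k σ h => ?_) hc
  rw [LinearMap.add_apply, LinearMap.comp_apply, LinearMap.comp_apply, LinearMap.id_apply,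
    coneTo_apply, coneTo_apply]
  match k, σ, h with
  | 0, σ, h => simp [single_zero_eq]
  | 1, σ, h =>
    rw [map_add, L.bdry_cone_single_one σ h, bdry_single_one, hp _ (h ⟨_, rfl⟩),
      emptyCoeff_single]
    simp
  | k + 2, σ, h =>
    rw [emptyCoeff_single, if_neg (by omega), zero_smul, add_zero, ← add_assoc,
      L.bdry_cone_single_succ_succ σ h, bdry_single_succ, map_sum]
    have : ∀ i : Fin (k + 2), emptyCoeff (single (σ.comp (simplexFace i))) = 0 :=
      fun i => emptyCoeff_single _
    simp only [map_smul, this]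
    simp

end LocalContraction

/-! ### Barycentric subdivision -/

namespace LocalContraction

/-- A deformation of the whole space to a point. -/
def ofPoint {X : Type*} [TopologicalSpace X] (H : C(unitInterval × X, X)) (p : X)
    (h0 : ∀ x, H (0, x) = x) (h1 : ∀ x, H (1, x) = p) :
    LocalContraction (Set.univ : Set X) where
  H s x := H (s, x)
  continuousOn := H.continuous.continuousOn
  zero x _ := h0 x
  mem _ _ _ := trivial
  locallyConstant x _ := Filter.Eventually.of_forall fun y => by rw [h1, h1]

end LocalContraction

/-- The straight line deformation of a standard simplex to one of its points. -/
def simplexDeform {k : ℕ} (b : stdSimplex ℝ (Fin k)) :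
    C(unitInterval × stdSimplex ℝ (Fin k), stdSimplex ℝ (Fin k)) where
  toFun p := ⟨(1 - (p.1 : ℝ)) • (p.2 : Fin k → ℝ) + (p.1 : ℝ) • (b : Fin k → ℝ),
    convex_stdSimplex ℝ (Fin k) p.2.2 b.2 (sub_nonneg.2 p.1.2.2) p.1.2.1 (by ring)⟩
  continuous_toFun := by
    refine Continuous.subtype_mk ?_ _
    change Continuous fun p : unitInterval × stdSimplex ℝ (Fin k) =>
      (1 - (p.1 : ℝ)) • p.2.1 + (p.1 : ℝ) • b.1
    fun_prop

/-- The contraction of a standard simplex to one of its points. -/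
def simplexContraction {k : ℕ} (b : stdSimplex ℝ (Fin k)) :
    LocalContraction (Set.univ : Set (stdSimplex ℝ (Fin k))) :=
  .ofPoint (simplexDeform b) b
    (fun x => stdSimplex.ext (by
      change (1 - ((0 : unitInterval) : ℝ)) • x.1 + ((0 : unitInterval) : ℝ) • b.1 = x.1
      simp))
    (fun x => stdSimplex.ext (by
      change (1 - ((1 : unitInterval) : ℝ)) • x.1 + ((1 : unitInterval) : ℝ) • b.1 = b.1
      simp))

/-- The contraction of a prism to a point of its bottom. -/
def prismContraction {k : ℕ} (b : stdSimplex ℝ (Fin k)) :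
    LocalContraction (Set.univ : Set (unitInterval × stdSimplex ℝ (Fin k))) :=
  .ofPoint ⟨fun p => (unitInterval.symm p.1 * p.2.1, simplexDeform b (p.1, p.2.2)), by
      fun_prop⟩ (0, b)
    (fun x => by
      refine Prod.ext ?_ ((simplexContraction b).zero x.2 trivial)
      change unitInterval.symm 0 * x.1 = x.1
      simp)
    (fun x => by
      refine Prod.ext ?_ (stdSimplex.ext ?_)
      · change unitInterval.symm 1 * x.1 = 0
        simp
      · change (1 - ((1 : unitInterval) : ℝ)) • x.2.1 + ((1 : unitInterval) : ℝ) • b.1 = b.1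
        simp)

namespace SingChain

variable {X Y : Type*} [TopologicalSpace X] [TopologicalSpace Y]

lemma single_eq_push {k : ℕ} (σ : C(stdSimplex ℝ (Fin k), X)) :
    single σ = push σ (single (ContinuousMap.id _)) := by
  rw [push_single, ContinuousMap.comp_id]

lemma cone_face_zero (k : ℕ) :
    (simplexContraction (stdSimplex.vertex (0 : Fin (k + 2)))).cone
      (single (simplexFace (k := k + 1) 0)) = single (ContinuousMap.id _) := by
  rw [LocalContraction.cone_single_succ _ _ (Set.subset_univ _)]
  congr 2
  ext1 u
  obtain ⟨⟨s, t⟩, rfl⟩ := coneMap_surjective k u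
  rw [LocalContraction.coneSimplex_coneMap, simplexFace_zero_eq_coneMap]
  refine stdSimplex.ext (funext fun i => Fin.cases ?_ (fun i => ?_) i)
  · change (1 - (s : ℝ)) * 0 + s * (Pi.single 0 1 : Fin (k + 2) → ℝ) 0 = s
    simp
  · change (1 - (s : ℝ)) * ((1 - 0) * t i) + s * (Pi.single 0 1 : Fin (k + 2) → ℝ) i.succ =
      (1 - (s : ℝ)) * t i
    simp

lemma bdry_bdry (c : SingChain X) : bdry (bdry c) = 0 := by
  suffices ∀ (k : ℕ) (σ : C(stdSimplex ℝ (Fin k), X)), bdry (bdry (single σ)) = 0 from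
    LinearMap.congr_fun (hom_ext (f := bdry ∘ₗ bdry) (g := 0) this) c
  intro k
  suffices bdry (bdry (single (ContinuousMap.id (stdSimplex ℝ (Fin k))))) = 0 by
    intro σ
    rw [single_eq_push, bdry_push, bdry_push, this, map_zero]
  induction k with
  | zero => simp
  | succ k ih =>
    cases k with
    | zero => rw [bdry_single_one, bdry_empty]
    | succ k =>
      set L := simplexContraction (stdSimplex.vertex (0 : Fin (k + 2)))
      set p := stdSimplex.vertex (S := ℝ) (0 : Fin (k + 2))
      have hp : ∀ x ∈ Set.univ, L.H 1 x = p := fun x _ => stdSimplex.ext (by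
        change (1 - ((1 : unitInterval) : ℝ)) • x.1 + ((1 : unitInterval) : ℝ) • p.1 = p.1
        simp)
      set F : SingChain (stdSimplex ℝ (Fin (k + 2))) := single (simplexFace (k := k + 1) 0)
        with hF
      have h1 : L.coneTo p F = single (ContinuousMap.id _) := by
        rw [L.coneTo_apply, cone_face_zero, hF, emptyCoeff_single]; simp
      have h2 := L.bdry_coneTo hp (mem_within_univ F)
      have h3 := L.bdry_coneTo hp (mem_within_univ (bdry F))
      have h4 : bdry (bdry F) = 0 := by
        rw [hF, single_eq_push, bdry_push, bdry_push, ih, map_zero]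
      rw [← h1, eq_sub_of_add_eq h2, map_sub, eq_sub_of_add_eq h3, h4]
      simp

/-- The barycentric subdivision of a standard simplex. -/
def sdModel : (k : ℕ) → SingChain (stdSimplex ℝ (Fin k))
  | 0 => empty _
  | k + 1 => (simplexContraction stdSimplex.barycenter).coneTo stdSimplex.barycenter
      (∑ i : Fin (k + 1), (-1 : ℚ) ^ (i : ℕ) • push (simplexFace i) (sdModel k))

/-- Barycentric subdivision. -/
def sd : SingChain X →ₗ[ℚ] SingChain X :=
  Finsupp.linearCombination ℚ fun σ => push σ.2 (sdModel σ.1)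

lemma sd_single {k : ℕ} (σ : C(stdSimplex ℝ (Fin k), X)) :
    sd (single σ) = push σ (sdModel k) := by simp [sd]

lemma sd_push (f : C(X, Y)) (c : SingChain X) : sd (push f c) = push f (sd c) := by
  suffices sd ∘ₗ push f = push f ∘ₗ sd from LinearMap.congr_fun this c
  refine hom_ext fun k σ => ?_
  rw [LinearMap.comp_apply, LinearMap.comp_apply, push_single, sd_single, sd_single, push_comp]

lemma sd_mem_within {U : Set X} {c : SingChain X} (hc : c ∈ within U) : sd c ∈ within U :=
  map_mem_of_single (fun k σ h => by
    rw [sd_single]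
    exact push_mem_within (fun t _ => h ⟨t, rfl⟩) (mem_within_univ _)) hc

@[simp] lemma sd_empty : sd (empty X) = empty X := by
  rw [empty, sd_single, sdModel, push_empty]; rfl

lemma sdModel_succ (k : ℕ) : sdModel (k + 1) =
    (simplexContraction stdSimplex.barycenter).coneTo stdSimplex.barycenter
      (sd (bdry (single (ContinuousMap.id (stdSimplex ℝ (Fin (k + 1))))))) := by
  rw [bdry_single_succ, map_sum, sdModel]
  simp only [map_smul, ContinuousMap.id_comp, sd_single]

lemma simplexContraction_one {k : ℕ} (b : stdSimplex ℝ (Fin k)) :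
    ∀ x ∈ Set.univ, (simplexContraction b).H 1 x = b := fun x _ => stdSimplex.ext (by
  change (1 - ((1 : unitInterval) : ℝ)) • x.1 + ((1 : unitInterval) : ℝ) • b.1 = b.1
  simp)

lemma prismContraction_one {k : ℕ} (b : stdSimplex ℝ (Fin k)) :
    ∀ x ∈ Set.univ, (prismContraction b).H 1 x = (0, b) := fun x _ => by
  refine Prod.ext ?_ (simplexContraction_one b x.2 trivial)
  change unitInterval.symm 1 * x.1 = 0
  simp

lemma bdry_sd (c : SingChain X) : bdry (sd c) = sd (bdry c) := by
  suffices ∀ (k : ℕ) (σ : C(stdSimplex ℝ (Fin k), X)),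
      bdry (sd (single σ)) = sd (bdry (single σ)) from
    LinearMap.congr_fun (hom_ext (f := bdry ∘ₗ sd) (g := sd ∘ₗ bdry) this) c
  intro k
  suffices bdry (sd (single (ContinuousMap.id (stdSimplex ℝ (Fin k))))) =
      sd (bdry (single (ContinuousMap.id (stdSimplex ℝ (Fin k))))) by
    intro σ
    rw [single_eq_push, sd_push, bdry_push, bdry_push, sd_push, this]
  induction k with
  | zero => rw [single_zero_eq]; simp
  | succ k ih =>
    have h : bdry (sd (bdry (single (ContinuousMap.id (stdSimplex ℝ (Fin (k + 1))))))) =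
        sd (bdry (bdry (single (ContinuousMap.id (stdSimplex ℝ (Fin (k + 1))))))) := by
      rw [bdry_single_succ]
      simp only [map_sum, map_smul, ContinuousMap.id_comp]
      refine Finset.sum_congr rfl fun i _ => ?_
      rw [single_eq_push (simplexFace i), sd_push, bdry_push, bdry_push, sd_push, ih]
    rw [sd_single, push_id, sdModel_succ]
    have := (simplexContraction stdSimplex.barycenter).bdry_coneTo (simplexContraction_one _)
      (mem_within_univ (sd (bdry (single (ContinuousMap.id (stdSimplex ℝ (Fin (k + 1))))))))
    rwa [h, bdry_bdry, map_zero, map_zero, add_zero] at this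

/-- The inclusion of `X` in the cylinder over `X` at height `s`. -/
def atHeight (s : unitInterval) : C(X, unitInterval × X) :=
  (ContinuousMap.const _ s).prodMk (ContinuousMap.id X)

/-- The map of cylinders induced by a map. -/
def cylinderMap (f : C(X, Y)) : C(unitInterval × X, unitInterval × Y) :=
  (ContinuousMap.id _).prodMap f

/-- The universal chain of the homotopy between the top of a cylinder and the subdivision of its
bottom. -/
def prismModel : (k : ℕ) → SingChain (unitInterval × stdSimplex ℝ (Fin k))
  | 0 => 0
  | k + 1 => (prismContraction stdSimplex.barycenter).coneTo (0, stdSimplex.barycenter)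
      (push (atHeight 1) (single (ContinuousMap.id _)) -
        push (atHeight 0) (sd (single (ContinuousMap.id _))) -
        ∑ i : Fin (k + 1), (-1 : ℚ) ^ (i : ℕ) • push (cylinderMap (simplexFace i)) (prismModel k))

/-- The chain homotopy between the top of a cylinder and the subdivision of its bottom. -/
def prism : SingChain X →ₗ[ℚ] SingChain (unitInterval × X) :=
  Finsupp.linearCombination ℚ fun σ => push (cylinderMap σ.2) (prismModel σ.1)

lemma prism_single {k : ℕ} (σ : C(stdSimplex ℝ (Fin k), X)) :
    prism (single σ) = push (cylinderMap σ) (prismModel k) := by simp [prism]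

lemma prism_push (f : C(X, Y)) (c : SingChain X) :
    prism (push f c) = push (cylinderMap f) (prism c) := by
  suffices prism ∘ₗ push f = push (cylinderMap f) ∘ₗ prism from LinearMap.congr_fun this c
  refine hom_ext fun k σ => ?_
  rw [LinearMap.comp_apply, LinearMap.comp_apply, push_single, prism_single, prism_single,
    ← push_comp]
  rfl

lemma prism_mem_within {U : Set X} {c : SingChain X} (hc : c ∈ within U) :
    prism c ∈ within (Set.univ ×ˢ U) :=
  map_mem_of_single (fun k σ h => by
    rw [prism_single]
    refine push_mem_within (U := Set.univ) (fun t _ => ?_) (mem_within_univ _)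
    exact Set.mk_mem_prod (Set.mem_univ _) (h ⟨t.2, rfl⟩)) hc

lemma push_atHeight (s : unitInterval) (f : C(X, Y)) (c : SingChain X) :
    push (atHeight s) (push f c) = push (cylinderMap f) (push (atHeight s) c) := by
  rw [← push_comp, ← push_comp]; rfl

lemma prismModel_succ (k : ℕ) : prismModel (k + 1) =
    (prismContraction stdSimplex.barycenter).coneTo (0, stdSimplex.barycenter)
      (push (atHeight 1) (single (ContinuousMap.id (stdSimplex ℝ (Fin (k + 1))))) -
        push (atHeight 0) (sd (single (ContinuousMap.id _))) -
        prism (bdry (single (ContinuousMap.id _)))) := by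
  rw [bdry_single_succ, map_sum, prismModel]
  simp only [map_smul, ContinuousMap.id_comp, prism_single]

lemma bdry_prism (c : SingChain X) :
    bdry (prism c) + prism (bdry c) = push (atHeight 1) c - push (atHeight 0) (sd c) := by
  suffices ∀ (k : ℕ) (σ : C(stdSimplex ℝ (Fin k), X)), bdry (prism (single σ)) +
      prism (bdry (single σ)) = push (atHeight 1) (single σ) -
        push (atHeight 0) (sd (single σ)) from
    LinearMap.congr_fun (hom_ext (f := bdry ∘ₗ prism + prism ∘ₗ bdry)
      (g := push (atHeight 1) - push (atHeight 0) ∘ₗ sd) this) c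
  intro k
  suffices bdry (prism (single (ContinuousMap.id (stdSimplex ℝ (Fin k))))) +
      prism (bdry (single (ContinuousMap.id (stdSimplex ℝ (Fin k))))) =
      push (atHeight 1) (single (ContinuousMap.id (stdSimplex ℝ (Fin k)))) -
        push (atHeight 0) (sd (single (ContinuousMap.id (stdSimplex ℝ (Fin k))))) by
    intro σ
    rw [single_eq_push, bdry_push, prism_push, prism_push, bdry_push, sd_push, ← map_add, this,
      push_atHeight, push_atHeight, map_sub]
  induction k with
  | zero =>
    rw [prism_single, prismModel, single_zero_eq]
    simp
  | succ k ih =>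
    set ι : SingChain (stdSimplex ℝ (Fin (k + 1))) := single (ContinuousMap.id _) with hι
    have h : bdry (prism (bdry ι)) + prism (bdry (bdry ι)) =
        push (atHeight 1) (bdry ι) - push (atHeight 0) (sd (bdry ι)) := by
      rw [hι, bdry_single_succ]
      simp only [map_sum, map_smul, ContinuousMap.id_comp, ← Finset.sum_add_distrib,
        ← Finset.sum_sub_distrib, ← smul_add, ← smul_sub]
      refine Finset.sum_congr rfl fun i _ => ?_
      rw [single_eq_push (simplexFace i), bdry_push, prism_push, prism_push, bdry_push, sd_push,
        ← map_add, ih, push_atHeight, push_atHeight, map_sub]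
    have hp : prism ι = prismModel (k + 1) := by
      rw [hι, prism_single]; exact push_id _
    rw [hp, prismModel_succ]
    set W := push (atHeight 1) ι - push (atHeight 0) (sd ι) - prism (bdry ι) with hW
    have hW0 : bdry W = 0 := by
      rw [bdry_bdry, map_zero, add_zero] at h
      rw [hW, map_sub, map_sub, h, bdry_push, bdry_push, bdry_sd, sub_self]
    have := (prismContraction stdSimplex.barycenter).bdry_coneTo (prismContraction_one _)
      (mem_within_univ W)
    rw [hW0, map_zero, add_zero] at this
    rw [this, hW, sub_add_cancel]

/-- The chain homotopy between the identity and barycentric subdivision. -/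
def sdHomotopy : SingChain X →ₗ[ℚ] SingChain X := push ContinuousMap.snd ∘ₗ prism

lemma bdry_sdHomotopy (c : SingChain X) :
    bdry (sdHomotopy c) + sdHomotopy (bdry c) = c - sd c := by
  have h := congrArg (push ContinuousMap.snd) (bdry_prism c)
  rw [map_add, map_sub, ← bdry_push, ← push_comp, ← push_comp] at h
  exact h.trans (congrArg₂ _ (push_id _) (push_id _))

lemma sdHomotopy_push (f : C(X, Y)) (c : SingChain X) :
    sdHomotopy (push f c) = push f (sdHomotopy c) := by
  rw [sdHomotopy, sdHomotopy, LinearMap.comp_apply, LinearMap.comp_apply, prism_push, ← push_comp,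
    ← push_comp]
  rfl

lemma sdHomotopy_mem_within {U : Set X} {c : SingChain X} (hc : c ∈ within U) :
    sdHomotopy c ∈ within U :=
  push_mem_within (fun _ h => h.2) (prism_mem_within hc)

/-- Homotopic maps induce homologous images of a cycle. -/
lemma exists_bdry_eq_of_homotopy (F : C(unitInterval × X, Y)) {U : Set X} {V : Set Y}
    (hF : ∀ s, ∀ x ∈ U, F (s, x) ∈ V) {c : SingChain X} (hc : c ∈ within U) (h : bdry c = 0) :
    ∃ w ∈ within V, bdry w = push (F.comp (atHeight 1)) c - push (F.comp (atHeight 0)) c := by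
  refine ⟨push F (prism c) - push (F.comp (atHeight 0)) (sdHomotopy c), Submodule.sub_mem _ ?_ ?_,
    ?_⟩
  · exact push_mem_within (fun p hp => hF p.1 p.2 hp.2) (prism_mem_within hc)
  · exact push_mem_within (fun p hp => hF 0 p hp) (sdHomotopy_mem_within hc)
  · have h1 := bdry_prism c
    have h2 := bdry_sdHomotopy c
    rw [h, map_zero, add_zero] at h1 h2
    rw [map_sub, bdry_push, bdry_push, h1, h2, map_sub, map_sub, ← push_comp, ← push_comp]
    abel

end SingChain

/-! ### Small simplices -/

/-- A map from a standard simplex to a normed space is affine, with vertices at mutual distance at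
most `d`. -/
def AffineSmall {E : Type*} [NormedAddCommGroup E] [NormedSpace ℝ E] {k : ℕ} (d : ℝ)
    (f : stdSimplex ℝ (Fin k) → E) : Prop :=
  ∃ v : Fin k → E, (∀ t, f t = ∑ i, t i • v i) ∧ ∀ i l, ‖v i - v l‖ ≤ d

namespace AffineSmall

variable {E : Type*} [NormedAddCommGroup E] [NormedSpace ℝ E] {k : ℕ} {d : ℝ}
  {f : stdSimplex ℝ (Fin k) → E}

lemma mono {d' : ℝ} (h : AffineSmall d f) (hd : d ≤ d') : AffineSmall d' f := by
  obtain ⟨v, hv, hd'⟩ := h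
  exact ⟨v, hv, fun i l => (hd' i l).trans hd⟩

lemma norm_sum_sub_le {v : Fin k → E} {z : E} (h : ∀ l, ‖v l - z‖ ≤ d)
    (t : stdSimplex ℝ (Fin k)) : ‖∑ i, t i • v i - z‖ ≤ d := by
  rw [← mem_closedBall_iff_norm]
  exact (convex_closedBall z d).sum_mem (fun i _ => t.2.1 i) t.2.2
    fun i _ => mem_closedBall_iff_norm.2 (h i)

lemma norm_sub_le (h : AffineSmall d f) (t t' : stdSimplex ℝ (Fin k)) : ‖f t - f t'‖ ≤ d := by
  obtain ⟨v, hv, hd⟩ := h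
  rw [hv t]
  refine norm_sum_sub_le (fun l => ?_) t
  rw [norm_sub_rev, hv t']
  exact norm_sum_sub_le (fun i => hd i l) t'

lemma norm_sub_barycenter_le {f : stdSimplex ℝ (Fin (k + 1)) → E} (h : AffineSmall d f)
    (t : stdSimplex ℝ (Fin (k + 1))) :
    ‖f t - f stdSimplex.barycenter‖ ≤ (1 - 1 / ((k : ℝ) + 1)) * d := by
  obtain ⟨v, hv, hd⟩ := h
  rw [hv t]
  refine norm_sum_sub_le (fun l => ?_) t
  have hk : ((k : ℝ) + 1) ≠ 0 := by positivity
  have h1 : v l - f stdSimplex.barycenter = (1 / ((k : ℝ) + 1)) • ∑ i, (v l - v i) := by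
    rw [hv, Finset.sum_sub_distrib, smul_sub, Finset.sum_const, Finset.card_univ,
      Fintype.card_fin, ← Nat.cast_smul_eq_nsmul ℝ, smul_smul, Finset.smul_sum]
    congr 1
    · rw [Nat.cast_succ, one_div_mul_cancel hk, one_smul]
    · refine Finset.sum_congr rfl fun i _ => ?_
      congr 1
      change ((Fintype.card (Fin (k + 1)) : ℕ) : ℝ)⁻¹ = 1 / ((k : ℝ) + 1)
      simp
  rw [h1, norm_smul, Real.norm_of_nonneg (by positivity), ← Finset.add_sum_erase _ _
    (Finset.mem_univ l), sub_self, zero_add]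
  have h2 : ‖∑ i ∈ Finset.univ.erase l, (v l - v i)‖ ≤ k * d := by
    refine (norm_sum_le_of_le _ fun i _ => hd l i).trans_eq ?_
    rw [Finset.sum_const, Finset.card_erase_of_mem (Finset.mem_univ l), Finset.card_univ,
      Fintype.card_fin, nsmul_eq_mul]
    simp
  refine (mul_le_mul_of_nonneg_left h2 (by positivity)).trans_eq ?_
  field_simp
  ring

lemma comp_face {f : stdSimplex ℝ (Fin (k + 1)) → E} (h : AffineSmall d f) (i : Fin (k + 1)) :
    AffineSmall d (f ∘ simplexFace i) := by
  obtain ⟨v, hv, hd⟩ := h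
  refine ⟨v ∘ i.succAbove, fun t => ?_, fun _ _ => hd _ _⟩
  rw [Function.comp_apply, hv, Fin.sum_univ_succAbove _ i, simplexFace_self, zero_smul, zero_add]
  simp only [simplexFace_succAbove, Function.comp_apply]

lemma comp_coneSimplex {j : ℕ} {e : ℝ} {f : stdSimplex ℝ (Fin k) → E} {b : stdSimplex ℝ (Fin k)}
    (hf : AffineSmall e f) (hb : ∀ t, ‖f t - f b‖ ≤ d) {ρ : C(stdSimplex ℝ (Fin (j + 1)), _)}
    (h : AffineSmall d (f ∘ ρ)) :
    AffineSmall d (f ∘ (simplexContraction b).coneSimplex ρ (Set.subset_univ _)) := by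
  obtain ⟨v, hv, -⟩ := hf
  obtain ⟨w, hw, hd⟩ := h
  have hw' : ∀ l, w l = f (ρ (stdSimplex.vertex l)) := fun l => by
    have := hw (stdSimplex.vertex l)
    rw [Function.comp_apply] at this
    rw [this, Finset.sum_eq_single l]
    · simp
    · intro i _ hi; simp [Pi.single_eq_of_ne hi]
    · simp
  refine ⟨Fin.cons (f b) w, fun u => ?_, ?_⟩
  · obtain ⟨⟨s, t⟩, rfl⟩ := coneMap_surjective _ u
    have h1 : ∀ l, ((simplexContraction b).H s (ρ t)) l = (1 - (s : ℝ)) * ρ t l + s * b l :=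
      fun l => rfl
    rw [Function.comp_apply, LocalContraction.coneSimplex_coneMap, Fin.sum_univ_succ, coneMap_zero,
      Fin.cons_zero]
    simp only [Fin.cons_succ, coneMap_succ, mul_smul, ← Finset.smul_sum]
    rw [← hw, Function.comp_apply, hv (ρ t), hv, hv b]
    simp only [h1, add_smul, mul_smul, Finset.sum_add_distrib, ← Finset.smul_sum]
    rw [add_comm]
  · have h0 : 0 ≤ d := (norm_nonneg _).trans (hd 0 0)
    refine Fin.cases (Fin.cases ?_ fun l => ?_) fun i => Fin.cases ?_ fun l => ?_
    · simpa using h0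
    · rw [Fin.cons_zero, Fin.cons_succ, norm_sub_rev, hw']; exact hb _
    · rw [Fin.cons_zero, Fin.cons_succ, hw']; exact hb _
    · exact hd i l

end AffineSmall

namespace SingChain

variable {X Y : Type*} [TopologicalSpace X] [TopologicalSpace Y]

/-- Chains of singular simplices with at most `N` vertices, whose composition with `f` is affine and
small. -/
def smallChains {E : Type*} [NormedAddCommGroup E] [NormedSpace ℝ E] (N : ℕ) (d : ℝ) (f : X → E) :
    Submodule ℚ (SingChain X) :=
  Finsupp.supported ℚ ℚ {ρ : SingSimplex X | ρ.1 ≤ N ∧ AffineSmall d (f ∘ ρ.2)}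

section

variable {E : Type*} [NormedAddCommGroup E] [NormedSpace ℝ E] {d : ℝ}

lemma map_mem_of_mem_smallChains {N : ℕ} {f : X → E} {M : Submodule ℚ (SingChain Y)}
    {φ : SingChain X →ₗ[ℚ] SingChain Y} (h : ∀ (k : ℕ) (ρ : C(stdSimplex ℝ (Fin k), X)), k ≤ N →
      AffineSmall d (f ∘ ρ) → φ (single ρ) ∈ M) {c : SingChain X} (hc : c ∈ smallChains N d f) :
    φ c ∈ M := by
  rw [smallChains, Finsupp.supported_eq_span_single] at hc
  induction hc using Submodule.span_induction with
  | mem x hx => obtain ⟨⟨k, σ⟩, ⟨h1, h2⟩, rfl⟩ := hx; exact h k σ h1 h2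
  | zero => simp
  | add a b _ _ ha hb => rw [map_add]; exact M.add_mem ha hb
  | smul r a _ ha => rw [map_smul]; exact M.smul_mem _ ha

lemma single_mem_smallChains {N k : ℕ} {f : X → E} {ρ : C(stdSimplex ℝ (Fin k), X)} (hk : k ≤ N)
    (h : AffineSmall d (f ∘ ρ)) : single ρ ∈ smallChains N d f :=
  Finsupp.single_mem_supported ℚ _ ⟨hk, h⟩

lemma smallChains_mono {N N' : ℕ} {d' : ℝ} (f : X → E) (hN : N ≤ N') (hd : d ≤ d') :
    smallChains N d f ≤ smallChains N' d' f :=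
  Finsupp.supported_mono fun _ hσ => ⟨hσ.1.trans hN, hσ.2.mono hd⟩

lemma push_mem_smallChains {N : ℕ} {g : C(X, Y)} {f : Y → E} {c : SingChain X}
    (hc : c ∈ smallChains N d (f ∘ g)) : push g c ∈ smallChains N d f :=
  map_mem_of_mem_smallChains (fun k ρ hk h => by
    rw [push_single]; exact single_mem_smallChains hk h) hc

lemma sdModel_mem_smallChains {N k : ℕ} (hd : 0 ≤ d) (hk : k ≤ N) {f : stdSimplex ℝ (Fin k) → E}
    (hf : AffineSmall d f) : sdModel k ∈ smallChains k ((1 - 1 / (N : ℝ)) * d) f := by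
  induction k with
  | zero => exact single_mem_smallChains le_rfl ⟨isEmptyElim, isEmptyElim, isEmptyElim⟩
  | succ k ih =>
    have hb : ∀ t, ‖f t - f stdSimplex.barycenter‖ ≤ (1 - 1 / (N : ℝ)) * d := fun t =>
      (hf.norm_sub_barycenter_le t).trans (mul_le_mul_of_nonneg_right (sub_le_sub_left
        (one_div_le_one_div_of_le (by positivity) (by exact_mod_cast hk)) 1) hd)
    have hc : ∑ i : Fin (k + 1), (-1 : ℚ) ^ (i : ℕ) • push (simplexFace i) (sdModel k) ∈
        smallChains k ((1 - 1 / (N : ℝ)) * d) f :=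
      Submodule.sum_mem _ fun i _ => Submodule.smul_mem _ _
        (push_mem_smallChains (ih (Nat.le_of_succ_le hk) (hf.comp_face i)))
    refine map_mem_of_mem_smallChains (fun j ρ hj h => ?_) hc
    rw [LocalContraction.coneTo_apply, emptyCoeff_single]
    cases j with
    | zero =>
      rw [LocalContraction.cone_single_zero, if_pos rfl, one_smul, zero_add]
      refine single_mem_smallChains (by omega) ⟨fun _ => f stdSimplex.barycenter, fun t => ?_,
        fun i l => ?_⟩
      · rw [← Finset.sum_smul, stdSimplex.sum_eq_one, one_smul]; rfl
      · have := hb stdSimplex.barycenter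
        rwa [sub_self] at this ⊢
    | succ j =>
      rw [LocalContraction.cone_single_succ _ _ (Set.subset_univ _), if_neg (by omega), zero_smul,
        add_zero]
      exact single_mem_smallChains (by omega) (hf.comp_coneSimplex hb h)

lemma sd_mem_smallChains {N : ℕ} (hd : 0 ≤ d) {f : X → E} {c : SingChain X}
    (hc : c ∈ smallChains N d f) : sd c ∈ smallChains N ((1 - 1 / (N : ℝ)) * d) f :=
  map_mem_of_mem_smallChains (fun k ρ hk h => by
    rw [sd_single]
    exact push_mem_smallChains (smallChains_mono _ hk le_rfl (sdModel_mem_smallChains hd hk h))) hc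

end

lemma single_id_mem_smallChains (N : ℕ) : single (ContinuousMap.id (stdSimplex ℝ (Fin N))) ∈
    smallChains N 1 (Subtype.val : stdSimplex ℝ (Fin N) → Fin N → ℝ) := by
  refine single_mem_smallChains le_rfl ⟨fun i => Pi.single i 1, fun t => ?_, fun i l => ?_⟩
  · change t.1 = _
    ext j
    simp [Finset.sum_apply, Pi.single_apply]
    rfl
  · rw [pi_norm_le_iff_of_nonneg zero_le_one]
    intro j
    simp only [Pi.sub_apply, Pi.single_apply]
    split_ifs <;> simp

lemma iterate_sd_push (f : C(X, Y)) (r : ℕ) (c : SingChain X) :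
    sd^[r] (push f c) = push f (sd^[r] c) :=
  ((show Function.Semiconj (push f) sd sd from fun c => (sd_push f c).symm).iterate_right r
    c).symm

lemma iterate_sd_mem_within {U : Set X} (r : ℕ) {c : SingChain X} (hc : c ∈ within U) :
    sd^[r] c ∈ within U := by
  induction r with
  | zero => exact hc
  | succ r ih => rw [Function.iterate_succ_apply']; exact sd_mem_within ih

lemma iterate_sd_mem_sup {U V : Set X} (r : ℕ) {c : SingChain X} (hc : c ∈ within U ⊔ within V) :
    sd^[r] c ∈ within U ⊔ within V := by
  induction r with
  | zero => exact hc
  | succ r ih =>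
    rw [Function.iterate_succ_apply']
    obtain ⟨a, ha, b, hb, h⟩ := Submodule.mem_sup.1 ih
    rw [← h, map_add]
    exact Submodule.add_mem_sup (sd_mem_within ha) (sd_mem_within hb)

lemma exists_iterate_sd_single_mem {U V : Set X} (hU : IsOpen U) (hV : IsOpen V) {N : ℕ}
    (σ : C(stdSimplex ℝ (Fin N), X)) (hσ : Set.range σ ⊆ U ∪ V) :
    ∃ r, sd^[r] (single σ) ∈ within U ⊔ within V := by
  rcases Nat.eq_zero_or_pos N with rfl | hN
  · exact ⟨0, Submodule.mem_sup_left (single_mem_within (by rintro _ ⟨t, -⟩; exact isEmptyElim t))⟩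
  obtain ⟨δ, hδ, h⟩ := lebesgue_number_lemma_of_metric
    (s := (Set.univ : Set (stdSimplex ℝ (Fin N))))
    (c := fun b : Bool => cond b (σ ⁻¹' U) (σ ⁻¹' V)) isCompact_univ
    (by rintro (_ | _); exacts [hV.preimage σ.continuous, hU.preimage σ.continuous])
    (by
      intro t _
      rcases hσ ⟨t, rfl⟩ with h | h
      exacts [Set.mem_iUnion.2 ⟨true, h⟩, Set.mem_iUnion.2 ⟨false, h⟩])
  have hN' : (1 : ℝ) ≤ N := by exact_mod_cast hN
  have h0 : (0 : ℝ) ≤ 1 - 1 / N := sub_nonneg.2 ((div_le_one (by positivity)).2 hN')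
  have h1 : (1 : ℝ) - 1 / N < 1 := by
    have : (0 : ℝ) < 1 / N := by positivity
    linarith
  obtain ⟨r, hr⟩ := exists_pow_lt_of_lt_one hδ h1
  refine ⟨r, ?_⟩
  have hs : sd^[r] (single (ContinuousMap.id (stdSimplex ℝ (Fin N)))) ∈
      smallChains N ((1 - 1 / (N : ℝ)) ^ r) (Subtype.val : _ → Fin N → ℝ) := by
    clear hr
    induction r with
    | zero => simpa using single_id_mem_smallChains N
    | succ r ih =>
      rw [Function.iterate_succ_apply', pow_succ']
      exact sd_mem_smallChains (pow_nonneg h0 r) ih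
  rw [single_eq_push, iterate_sd_push]
  refine map_mem_of_mem_smallChains (fun k ρ _ hρ => ?_) hs
  rw [push_single]
  cases k with
  | zero =>
    exact Submodule.mem_sup_left (single_mem_within (by rintro _ ⟨t, -⟩; exact isEmptyElim t))
  | succ k =>
    obtain ⟨b, hb⟩ := h (ρ stdSimplex.barycenter) trivial
    have hρ' : ∀ t, ρ t ∈ Metric.ball (ρ stdSimplex.barycenter) δ := fun t => by
      rw [Metric.mem_ball, Subtype.dist_eq, dist_eq_norm]
      exact (hρ.norm_sub_le t _).trans_lt hr
    cases b with
    | true =>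
      refine Submodule.mem_sup_left (single_mem_within ?_)
      rintro _ ⟨t, rfl⟩
      exact hb (hρ' t)
    | false =>
      refine Submodule.mem_sup_right (single_mem_within ?_)
      rintro _ ⟨t, rfl⟩
      exact hb (hρ' t)

lemma iterate_sd_add (r : ℕ) (a b : SingChain X) : sd^[r] (a + b) = sd^[r] a + sd^[r] b := by
  rw [← Module.End.coe_pow, map_add]

/-- Every chain in a union of two open sets is small after enough subdivisions. -/
lemma exists_iterate_sd_mem {U V : Set X} (hU : IsOpen U) (hV : IsOpen V) {c : SingChain X}
    (hc : c ∈ within (U ∪ V)) : ∃ r, sd^[r] c ∈ within U ⊔ within V := by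
  refine within_induction (p := fun c => ∃ r, sd^[r] c ∈ within U ⊔ within V) hc
    (fun k σ hσ => exists_iterate_sd_single_mem hU hV σ hσ) ⟨0, Submodule.zero_mem _⟩ ?_ ?_
  · rintro a b ⟨r, hr⟩ ⟨s, hs⟩
    refine ⟨r + s, ?_⟩
    rw [iterate_sd_add]
    refine Submodule.add_mem _ ?_ ?_
    · rw [add_comm, Function.iterate_add_apply]; exact iterate_sd_mem_sup s hr
    · rw [Function.iterate_add_apply]; exact iterate_sd_mem_sup r hs
  · rintro q a ⟨r, hr⟩
    refine ⟨r, ?_⟩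
    rw [← Module.End.coe_pow, map_smul] at *
    exact Submodule.smul_mem _ _ hr

/-- The chain homotopy between the identity and the iterated subdivision. -/
def sdHomotopyIter : ℕ → SingChain X →ₗ[ℚ] SingChain X
  | 0 => 0
  | r + 1 => sdHomotopy ∘ₗ (sd ^ r) + sdHomotopyIter r

lemma bdry_iterate_sd (r : ℕ) (c : SingChain X) : bdry (sd^[r] c) = sd^[r] (bdry c) :=
  (show Function.Semiconj bdry sd sd from bdry_sd).iterate_right r c

lemma bdry_sdHomotopyIter (r : ℕ) (c : SingChain X) :
    bdry (sdHomotopyIter r c) + sdHomotopyIter r (bdry c) = c - sd^[r] c := by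
  induction r with
  | zero => simp [sdHomotopyIter]
  | succ r ih =>
    have := bdry_sdHomotopy (sd^[r] c)
    rw [sdHomotopyIter, LinearMap.add_apply, LinearMap.add_apply, LinearMap.comp_apply,
      LinearMap.comp_apply, Module.End.coe_pow, ← bdry_iterate_sd, map_add,
      Function.iterate_succ_apply', add_add_add_comm, this, ih]
    abel

lemma sdHomotopyIter_push (f : C(X, Y)) (r : ℕ) (c : SingChain X) :
    sdHomotopyIter r (push f c) = push f (sdHomotopyIter r c) := by
  induction r with
  | zero => simp [sdHomotopyIter]
  | succ r ih =>
    rw [sdHomotopyIter, sdHomotopyIter, LinearMap.add_apply, LinearMap.add_apply,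
      LinearMap.comp_apply, LinearMap.comp_apply, Module.End.coe_pow, Module.End.coe_pow,
      iterate_sd_push, sdHomotopy_push, ih, map_add]

lemma sdHomotopyIter_mem_within {U : Set X} (r : ℕ) {c : SingChain X} (hc : c ∈ within U) :
    sdHomotopyIter r c ∈ within U := by
  induction r with
  | zero => exact Submodule.zero_mem _
  | succ r ih =>
    refine Submodule.add_mem _ (sdHomotopy_mem_within ?_) ih
    rw [Module.End.coe_pow]
    exact iterate_sd_mem_within r hc

end SingChain

/-! ### Homology of subspaces and suspension -/

lemma nonempty_quotient_equiv {M M₁ M₂ : Type*} [AddCommGroup M] [AddCommGroup M₁]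
    [AddCommGroup M₂] [Module ℚ M] [Module ℚ M₁] [Module ℚ M₂] (f : M →ₗ[ℚ] M₁) (g : M →ₗ[ℚ] M₂)
    (B₁ : Submodule ℚ M₁) (B₂ : Submodule ℚ M₂) (hf : ∀ z, ∃ m, f m - z ∈ B₁)
    (hg : ∀ z, ∃ m, g m - z ∈ B₂) (h : ∀ m, f m ∈ B₁ ↔ g m ∈ B₂) :
    Nonempty ((M₁ ⧸ B₁) ≃ₗ[ℚ] (M₂ ⧸ B₂)) := by
  have h₁ : Function.Surjective (B₁.mkQ ∘ₗ f) := fun q => by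
    obtain ⟨z, rfl⟩ := B₁.mkQ_surjective q
    obtain ⟨m, hm⟩ := hf z
    exact ⟨m, (Submodule.Quotient.eq B₁).2 hm⟩
  have h₂ : Function.Surjective (B₂.mkQ ∘ₗ g) := fun q => by
    obtain ⟨z, rfl⟩ := B₂.mkQ_surjective q
    obtain ⟨m, hm⟩ := hg z
    exact ⟨m, (Submodule.Quotient.eq B₂).2 hm⟩
  have hk : LinearMap.ker (B₁.mkQ ∘ₗ f) = LinearMap.ker (B₂.mkQ ∘ₗ g) := by
    rw [LinearMap.ker_comp, LinearMap.ker_comp, Submodule.ker_mkQ, Submodule.ker_mkQ]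
    ext m
    exact h m
  exact ⟨((B₁.mkQ ∘ₗ f).quotKerEquivOfSurjective h₁).symm ≪≫ₗ Submodule.quotEquivOfEq _ _ hk ≪≫ₗ
    (B₂.mkQ ∘ₗ g).quotKerEquivOfSurjective h₂⟩

namespace SingChain

variable {X Y : Type*} [TopologicalSpace X] [TopologicalSpace Y]

/-- The cycles in `U` of simplices with `k` vertices. -/
def cycles (U : Set X) (k : ℕ) : Submodule ℚ (SingChain X) :=
  within U ⊓ ofDegree X k ⊓ LinearMap.ker bdry

/-- The boundaries in `U` of simplices with `k` vertices. -/
def boundaries (U : Set X) (k : ℕ) : Submodule ℚ (SingChain X) :=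
  (within U ⊓ ofDegree X (k + 1)).map bdry

/-- The reduced homology of `U` in degree `k - 1`. -/
abbrev Homology (U : Set X) (k : ℕ) : Type _ :=
  cycles U k ⧸ (boundaries U k).comap (cycles U k).subtype

lemma mem_cycles {U : Set X} {k : ℕ} {c : SingChain X} :
    c ∈ cycles U k ↔ c ∈ within U ∧ c ∈ ofDegree X k ∧ bdry c = 0 := by
  rw [cycles, Submodule.mem_inf, Submodule.mem_inf, LinearMap.mem_ker, and_assoc]

lemma bdry_mem_boundaries {U : Set X} {k : ℕ} {w : SingChain X} (hw : w ∈ within U)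
    (h : bdry w ∈ ofDegree X k) : bdry w ∈ boundaries U k :=
  ⟨component (k + 1) w, ⟨component_mem_within _ hw, component_mem_ofDegree _ _⟩, by
    rw [bdry_component_succ, component_of_mem h]⟩

lemma exists_of_mem_boundaries {U : Set X} {k : ℕ} {c : SingChain X} (h : c ∈ boundaries U k) :
    ∃ w ∈ within U, w ∈ ofDegree X (k + 1) ∧ bdry w = c := by
  obtain ⟨w, ⟨hw, hk⟩, rfl⟩ := h
  exact ⟨w, hw, hk, rfl⟩

lemma nonempty_homology_equiv {W : Type*} [AddCommGroup W] [Module ℚ W] (M : Submodule ℚ W)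
    {U : Set X} {V : Set Y} {k l : ℕ} (f : W →ₗ[ℚ] SingChain X) (g : W →ₗ[ℚ] SingChain Y)
    (hf : ∀ m ∈ M, f m ∈ cycles U k) (hg : ∀ m ∈ M, g m ∈ cycles V l)
    (hf' : ∀ z ∈ cycles U k, ∃ m ∈ M, f m - z ∈ boundaries U k)
    (hg' : ∀ z ∈ cycles V l, ∃ m ∈ M, g m - z ∈ boundaries V l)
    (h : ∀ m ∈ M, f m ∈ boundaries U k ↔ g m ∈ boundaries V l) :
    Nonempty (Homology U k ≃ₗ[ℚ] Homology V l) := by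
  refine nonempty_quotient_equiv (f.restrict hf) (g.restrict hg) _ _ ?_ ?_ fun m => h m.1 m.2
  · rintro ⟨z, hz⟩
    obtain ⟨m, hm, h⟩ := hf' z hz
    exact ⟨⟨m, hm⟩, h⟩
  · rintro ⟨z, hz⟩
    obtain ⟨m, hm, h⟩ := hg' z hz
    exact ⟨⟨m, hm⟩, h⟩

lemma subsingleton_homology {U : Set X} {k : ℕ} (h : ∀ z ∈ cycles U k, z ∈ boundaries U k) :
    Subsingleton (Homology U k) :=
  Submodule.Quotient.subsingleton_iff.2 (eq_top_iff.2 fun z _ => h z.1 z.2)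

lemma mem_boundaries_of_subsingleton {U : Set X} {k : ℕ} (h : Subsingleton (Homology U k))
    {z : SingChain X} (hz : z ∈ cycles U k) : z ∈ boundaries U k := by
  have := Submodule.Quotient.subsingleton_iff.1 h
  exact (this ▸ Submodule.mem_top : (⟨z, hz⟩ : cycles U k) ∈
    (boundaries U k).comap (cycles U k).subtype)

/-- Every cycle in `U` is a boundary in `U`. -/
def Acyclic (U : Set X) : Prop :=
  ∀ c ∈ within U, bdry c = 0 → ∃ w ∈ within U, bdry w = c

lemma Acyclic.exists_ofDegree {U : Set X} (h : Acyclic U) {k : ℕ} {c : SingChain X}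
    (hc : c ∈ within U) (hk : c ∈ ofDegree X k) (h0 : bdry c = 0) :
    ∃ w ∈ within U, w ∈ ofDegree X (k + 1) ∧ bdry w = c := by
  obtain ⟨w, hw, rfl⟩ := h c hc h0
  exact exists_of_mem_boundaries (bdry_mem_boundaries hw hk)

lemma _root_.LocalContraction.acyclic {U : Set X} (L : LocalContraction U) {p : X} (hp : p ∈ U)
    (h : ∀ x ∈ U, L.H 1 x = p) : Acyclic U := fun c hc h0 =>
  ⟨L.coneTo p c, L.coneTo_mem_within hp hc, by
    have := L.bdry_coneTo h hc
    rwa [h0, map_zero, add_zero] at this⟩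

lemma mem_boundaries_inter_of_sub_mem {A B : Set X} (hA : IsOpen A) (hB : IsOpen B) {k : ℕ}
    {a b : SingChain X} (ha : a ∈ within A) (hak : a ∈ ofDegree X (k + 1)) (hb : b ∈ within B)
    (hab : bdry a = bdry b) (h : a - b ∈ boundaries (A ∪ B) (k + 1)) :
    bdry a ∈ boundaries (A ∩ B) k := by
  obtain ⟨w, hw, -, hwab⟩ := exists_of_mem_boundaries h
  obtain ⟨r, hr⟩ := exists_iterate_sd_mem hA hB hw
  obtain ⟨wA, hwA, wB, hwB, hwr⟩ := Submodule.mem_sup.1 hr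
  set T := sdHomotopyIter (X := X) r
  have h1 : bdry (T (a - b)) = a - b - bdry (wA + wB) := by
    have := bdry_sdHomotopyIter r (a - b)
    rw [map_sub bdry, hab, sub_self, map_zero, add_zero] at this
    rw [this, hwr, bdry_iterate_sd, hwab]
  set c := a - bdry (T a) - bdry wA with hc
  have hc' : c = b - bdry (T b) + bdry wB := by
    rw [map_sub, map_sub, map_add] at h1
    rw [hc, ← sub_eq_zero]
    have := sub_eq_zero.2 h1
    rw [← neg_eq_zero, ← this]
    abel
  have hcm : c ∈ within (A ∩ B) := by
    rw [within_inter]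
    refine ⟨?_, ?_⟩
    · exact Submodule.sub_mem _ (Submodule.sub_mem _ ha
        (bdry_mem_within (sdHomotopyIter_mem_within r ha))) (bdry_mem_within hwA)
    · rw [hc']
      exact Submodule.add_mem _ (Submodule.sub_mem _ hb
        (bdry_mem_within (sdHomotopyIter_mem_within r hb))) (bdry_mem_within hwB)
  have hbc : bdry a = bdry c := by
    rw [hc, map_sub, map_sub, bdry_bdry, bdry_bdry, sub_zero, sub_zero]
  rw [hbc]
  exact bdry_mem_boundaries hcm (hbc ▸ bdry_mem_ofDegree hak)

/-- The suspension isomorphism. -/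
lemma nonempty_suspension_equiv {A B : Set X} (hA : IsOpen A) (hB : IsOpen B) (hA' : Acyclic A)
    (hB' : Acyclic B) (k : ℕ) :
    Nonempty (Homology (A ∪ B) (k + 1) ≃ₗ[ℚ] Homology (A ∩ B) k) := by
  let M : Submodule ℚ (SingChain X × SingChain X) :=
    (within A ⊓ ofDegree X (k + 1)).prod (within B ⊓ ofDegree X (k + 1)) ⊓
      LinearMap.ker (bdry ∘ₗ LinearMap.fst ℚ _ _ - bdry ∘ₗ LinearMap.snd ℚ _ _)
  have hM : ∀ m, m ∈ M ↔ ((m.1 ∈ within A ∧ m.1 ∈ ofDegree X (k + 1)) ∧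
      m.2 ∈ within B ∧ m.2 ∈ ofDegree X (k + 1)) ∧ bdry m.1 = bdry m.2 := fun m => by
    simp [M, Submodule.mem_inf, Submodule.mem_prod, sub_eq_zero]
  refine nonempty_homology_equiv M (LinearMap.fst ℚ _ _ - LinearMap.snd ℚ _ _)
    (bdry ∘ₗ LinearMap.fst ℚ _ _) ?_ ?_ ?_ ?_ ?_
  · rintro ⟨a, b⟩ hm
    obtain ⟨⟨⟨ha, hak⟩, hb, hbk⟩, hab⟩ := (hM _).1 hm
    refine mem_cycles.2 ⟨Submodule.sub_mem _ (within_mono Set.subset_union_left ha)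
      (within_mono Set.subset_union_right hb), Submodule.sub_mem _ hak hbk, ?_⟩
    exact (map_sub bdry a b).trans (sub_eq_zero.2 hab)
  · rintro ⟨a, b⟩ hm
    obtain ⟨⟨⟨ha, hak⟩, hb, hbk⟩, hab⟩ := (hM _).1 hm
    refine mem_cycles.2 ⟨?_, bdry_mem_ofDegree hak, bdry_bdry _⟩
    rw [within_inter]
    exact ⟨bdry_mem_within ha, (hab ▸ bdry_mem_within hb : bdry a ∈ within B)⟩
  · intro z hz
    obtain ⟨hz1, hz2, hz3⟩ := mem_cycles.1 hz
    obtain ⟨r, hr⟩ := exists_iterate_sd_mem hA hB hz1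
    obtain ⟨a, ha, b, hb, hab⟩ := Submodule.mem_sup.1 hr
    have hT := bdry_sdHomotopyIter r z
    rw [hz3, map_zero, add_zero, ← hab] at hT
    refine ⟨(component (k + 1) a, - component (k + 1) b), (hM _).2 ⟨⟨⟨component_mem_within _ ha,
      component_mem_ofDegree _ _⟩, Submodule.neg_mem _ (component_mem_within _ hb),
      Submodule.neg_mem _ (component_mem_ofDegree _ _)⟩, ?_⟩, ?_⟩
    · have : bdry a + bdry b = 0 := by
        rw [← map_add, hab, bdry_iterate_sd, hz3, ← Module.End.coe_pow, map_zero]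
      rw [map_neg, bdry_component_succ, bdry_component_succ, ← map_neg, eq_neg_of_add_eq_zero_left
        this]
    · have h1 : component (k + 1) a - -component (k + 1) b - z =
          bdry (- component (k + 2) (sdHomotopyIter r z)) := by
        rw [map_neg, bdry_component_succ, hT, map_sub, map_add, component_of_mem hz2]
        abel
      change component (k + 1) a - -component (k + 1) b - z ∈ _
      rw [h1]
      refine bdry_mem_boundaries (Submodule.neg_mem _
        (component_mem_within _ (sdHomotopyIter_mem_within r hz1))) ?_
      exact bdry_mem_ofDegree (Submodule.neg_mem _ (component_mem_ofDegree _ _))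
  · intro z hz
    obtain ⟨hz1, hz2, hz3⟩ := mem_cycles.1 hz
    rw [within_inter] at hz1
    obtain ⟨a, ha, hak, rfl⟩ := hA'.exists_ofDegree hz1.1 hz2 hz3
    obtain ⟨b, hb, hbk, hab⟩ := hB'.exists_ofDegree hz1.2 hz2 hz3
    refine ⟨(a, b), (hM _).2 ⟨⟨⟨ha, hak⟩, hb, hbk⟩, hab.symm⟩, ?_⟩
    change bdry a - bdry a ∈ _
    rw [sub_self]
    exact Submodule.zero_mem _
  · rintro ⟨a, b⟩ hm
    obtain ⟨⟨⟨ha, hak⟩, hb, hbk⟩, hab⟩ := (hM _).1 hm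
    refine ⟨fun h => mem_boundaries_inter_of_sub_mem hA hB ha hak hb hab h, fun h => ?_⟩
    obtain ⟨c, hc, hck, hca⟩ := exists_of_mem_boundaries h
    replace hca : bdry c = bdry a := hca
    rw [within_inter] at hc
    obtain ⟨u, hu, hu'⟩ := hA' (a - c) (Submodule.sub_mem _ ha hc.1) (by
      rw [map_sub, hca, sub_self])
    obtain ⟨v, hv, hv'⟩ := hB' (b - c) (Submodule.sub_mem _ hb hc.2) (by
      rw [map_sub, hca]; exact sub_eq_zero.2 hab.symm)
    have h1 : a - b = bdry (u - v) := by rw [map_sub, hu', hv']; abel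
    change a - b ∈ _
    rw [h1]
    refine bdry_mem_boundaries (Submodule.sub_mem _ (within_mono Set.subset_union_left hu)
      (within_mono Set.subset_union_right hv)) ?_
    rw [← h1]
    exact Submodule.sub_mem _ hak hbk

lemma eq_smul_empty {c : SingChain X} (hc : c ∈ ofDegree X 0) : c = emptyCoeff c • empty X := by
  rw [ofDegree, Finsupp.supported_eq_span_single] at hc
  induction hc using Submodule.span_induction with
  | mem x hx =>
    obtain ⟨⟨k, σ⟩, h, rfl⟩ := hx
    obtain rfl : k = 0 := h
    change single σ = emptyCoeff (single σ) • empty X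
    rw [emptyCoeff_single, if_pos rfl, one_smul, single_zero_eq]
  | zero => simp
  | add a b _ _ ha hb => rw [map_add, add_smul, ← ha, ← hb]
  | smul r a _ ha => rw [map_smul, smul_assoc, ← ha]

lemma empty_mem_ofDegree : empty X ∈ ofDegree X 0 := Finsupp.single_mem_supported ℚ _ rfl

lemma subsingleton_homology_zero {U : Set X} (hU : U.Nonempty) : Subsingleton (Homology U 0) := by
  refine subsingleton_homology fun z hz => ?_
  obtain ⟨x, hx⟩ := hU
  rw [eq_smul_empty (mem_cycles.1 hz).2.1, ← bdry_point x]
  refine Submodule.smul_mem _ _ (bdry_mem_boundaries (point_mem_within hx) ?_)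
  rw [bdry_point]
  exact empty_mem_ofDegree

lemma component_succ_eq_zero (k : ℕ) {c : SingChain X} (hc : c ∈ within (∅ : Set X)) :
    component (k + 1) c = 0 := by
  refine eqOn_within (g := 0) (fun j σ h => ?_) hc
  cases j with
  | zero => rw [component_single, if_neg (Nat.succ_ne_zero k).symm]; rfl
  | succ j => exact absurd (h ⟨stdSimplex.barycenter, rfl⟩) (Set.notMem_empty _)

/-- The reduced homology of `U` is `ℚ` in degree `d - 1` and zero in all others. -/
def IsHomologySphere (U : Set X) (d : ℕ) : Prop :=
  Nonempty (Homology U d ≃ₗ[ℚ] ℚ) ∧ ∀ k, k ≠ d → Subsingleton (Homology U k)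

lemma isHomologySphere_empty : IsHomologySphere (∅ : Set X) 0 := by
  refine ⟨⟨?_⟩, fun k hk => ?_⟩
  · have hB : (boundaries (∅ : Set X) 0).comap (cycles ∅ 0).subtype =
        LinearMap.ker (emptyCoeff.domRestrict (cycles (∅ : Set X) 0)) := by
      ext ⟨z, hz⟩
      rw [Submodule.mem_comap, LinearMap.mem_ker]
      refine ⟨fun h => ?_, fun h => ?_⟩
      · obtain ⟨w, hw, hk, h⟩ := exists_of_mem_boundaries h
        rw [← component_of_mem hk, component_succ_eq_zero 0 hw, map_zero] at h
        change emptyCoeff z = 0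
        rw [show z = 0 from h.symm, map_zero]
      · change z ∈ _
        rw [eq_smul_empty (mem_cycles.1 hz).2.1, show emptyCoeff z = 0 from h, zero_smul]
        exact Submodule.zero_mem _
    refine Submodule.quotEquivOfEq _ _ hB ≪≫ₗ LinearMap.quotKerEquivOfSurjective _ fun q => ?_
    refine ⟨⟨q • empty X, Submodule.smul_mem _ _ (mem_cycles.2 ⟨empty_mem_within _,
      empty_mem_ofDegree, bdry_empty⟩)⟩, ?_⟩
    change emptyCoeff (q • empty X) = q
    simp
  · obtain ⟨k, rfl⟩ := Nat.exists_eq_succ_of_ne_zero hk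
    refine subsingleton_homology fun z hz => ?_
    obtain ⟨hz, hzk, -⟩ := mem_cycles.1 hz
    rw [← component_of_mem hzk, component_succ_eq_zero k hz]
    exact Submodule.zero_mem _

lemma IsHomologySphere.congr {U : Set X} {V : Set Y} {d : ℕ} (h : IsHomologySphere U d)
    (e : ∀ k, Nonempty (Homology U k ≃ₗ[ℚ] Homology V k)) : IsHomologySphere V d :=
  ⟨⟨(e d).some.symm ≪≫ₗ h.1.some⟩, fun k hk =>
    have := h.2 k hk
    (e k).some.symm.toEquiv.subsingleton⟩

lemma IsHomologySphere.suspension {A B : Set X} {d : ℕ} (hA : IsOpen A) (hB : IsOpen B)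
    (hA' : Acyclic A) (hB' : Acyclic B) (hne : (A ∪ B).Nonempty) (h : IsHomologySphere (A ∩ B) d) :
    IsHomologySphere (A ∪ B) (d + 1) := by
  refine ⟨⟨(nonempty_suspension_equiv hA hB hA' hB' d).some ≪≫ₗ h.1.some⟩, fun k hk => ?_⟩
  cases k with
  | zero => exact subsingleton_homology_zero hne
  | succ k =>
    have := h.2 k (by omega)
    exact (nonempty_suspension_equiv hA hB hA' hB' k).some.toEquiv.subsingleton

end SingChain

/-! ### The homology of a punctured Euclidean space -/

/-- The straight line contraction of a star-shaped set to its centre. -/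
def LocalContraction.ofStarConvex {E : Type*} [NormedAddCommGroup E] [NormedSpace ℝ E] {U : Set E}
    {p : E} (h : StarConvex ℝ p U) : LocalContraction U where
  H s x := (s : ℝ) • p + (1 - (s : ℝ)) • x
  continuousOn := by fun_prop
  zero x _ := by simp
  mem s x hx := h hx s.2.1 (sub_nonneg.2 s.2.2) (by ring)
  locallyConstant x _ := Filter.Eventually.of_forall fun y => by simp

lemma StarConvex.acyclic {E : Type*} [NormedAddCommGroup E] [NormedSpace ℝ E] {U : Set E}
    {p : E} (h : StarConvex ℝ p U) (hp : p ∈ U) : SingChain.Acyclic U :=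
  (LocalContraction.ofStarConvex h).acyclic hp fun x _ => by
    change ((1 : unitInterval) : ℝ) • p + (1 - ((1 : unitInterval) : ℝ)) • x = p
    simp

namespace SingChain

section

variable {n : ℕ}

/-- The points of Euclidean space with a nonzero coordinate among the first `j` ones, or whose
next coordinate has the same sign as `ε`. -/
def signedPunctured (j : Fin n) (ε : ℝ) : Set (EuclideanSpace ℝ (Fin n)) :=
  {x | (∃ i < j, x i ≠ 0) ∨ 0 < ε * x j}

lemma isOpen_signedPunctured (j : Fin n) (ε : ℝ) : IsOpen (signedPunctured j ε) := by
  have : signedPunctured j ε = (⋃ i, ⋃ _ : i < j, {x : EuclideanSpace ℝ (Fin n) | x i ≠ 0}) ∪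
      {x | 0 < ε * x j} := by
    ext x; simp [signedPunctured]
  rw [this]
  refine IsOpen.union (isOpen_iUnion fun i => isOpen_iUnion fun _ => ?_) ?_
  · exact isOpen_ne_fun (by fun_prop) continuous_const
  · exact isOpen_lt continuous_const (by fun_prop)

lemma acyclic_signedPunctured (j : Fin n) {ε : ℝ} (hε : ε ≠ 0) : Acyclic (signedPunctured j ε) := by
  have h0 : 0 < ε * ε := mul_self_pos.2 hε
  have hp : EuclideanSpace.single j ε ∈ signedPunctured j ε := Or.inr (by simpa using h0)
  refine StarConvex.acyclic (p := EuclideanSpace.single j ε) ?_ hp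
  intro x hx a b ha hb hab
  rcases hb.eq_or_lt with rfl | hb
  · obtain rfl : a = 1 := by linarith
    simpa using hp
  rcases hx with ⟨i, hi, hx⟩ | hx
  · refine Or.inl ⟨i, hi, ?_⟩
    simp [hi.ne, hx, hb.ne']
  · refine Or.inr ?_
    simp only [PiLp.add_apply, PiLp.smul_apply, smul_eq_mul, PiLp.single_apply, if_true]
    nlinarith [mul_nonneg ha h0.le, mul_pos hb hx]

lemma isHomologySphere_exists_ne_zero {j : ℕ} (hj : j ≤ n) :
    IsHomologySphere {x : EuclideanSpace ℝ (Fin n) | ∃ i : Fin n, (i : ℕ) < j ∧ x i ≠ 0} j := by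
  induction j with
  | zero => simpa using isHomologySphere_empty
  | succ j ih =>
    set l : Fin n := ⟨j, hj⟩
    have h1 : {x : EuclideanSpace ℝ (Fin n) | ∃ i : Fin n, (i : ℕ) < j ∧ x i ≠ 0} =
        signedPunctured l 1 ∩ signedPunctured l (-1) := by
      ext x
      refine ⟨fun h => ⟨Or.inl h, Or.inl h⟩, ?_⟩
      rintro ⟨h | h, h' | h'⟩
      exacts [h, h, h', by linarith]
    have h2 : {x : EuclideanSpace ℝ (Fin n) | ∃ i : Fin n, (i : ℕ) < j + 1 ∧ x i ≠ 0} =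
        signedPunctured l 1 ∪ signedPunctured l (-1) := by
      ext x
      constructor
      · rintro ⟨i, hi, hx⟩
        rcases Nat.lt_succ_iff_lt_or_eq.1 hi with hi | hi
        · exact Or.inl (Or.inl ⟨i, hi, hx⟩)
        · obtain rfl : i = l := Fin.ext hi
          rcases hx.lt_or_gt with hx | hx
          · exact Or.inr (Or.inr (by linarith))
          · exact Or.inl (Or.inr (by linarith))
      · rintro ((⟨i, hi, hx⟩ | hx) | (⟨i, hi, hx⟩ | hx))
        · exact ⟨i, Nat.lt_succ_of_lt hi, hx⟩
        · exact ⟨l, Nat.lt_succ_self j, fun h => by simp [h] at hx⟩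
        · exact ⟨i, Nat.lt_succ_of_lt hi, hx⟩
        · exact ⟨l, Nat.lt_succ_self j, fun h => by simp [h] at hx⟩
    rw [h2]
    have ih := ih (Nat.le_of_succ_le hj)
    rw [h1] at ih
    refine ih.suspension (isOpen_signedPunctured _ _) (isOpen_signedPunctured _ _)
      (acyclic_signedPunctured _ one_ne_zero) (acyclic_signedPunctured _ (by norm_num)) ?_
    exact ⟨EuclideanSpace.single l 1, Or.inl (Or.inr (by simp))⟩

lemma isHomologySphere_compl_zero (n : ℕ) :
    IsHomologySphere ({0}ᶜ : Set (EuclideanSpace ℝ (Fin n))) n := by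
  convert isHomologySphere_exists_ne_zero le_rfl
  ext x
  simp only [Set.mem_compl_iff, Set.mem_singleton_iff, Fin.is_lt, true_and, Set.mem_ofPred_eq]
  rw [← not_forall_not]
  simp only [not_not]
  exact not_congr ⟨fun h i => by simp [h], fun h => PiLp.ext h⟩

end

end SingChain

/-! ### Invariant chains and chains of the orbit space -/

/-- An open continuous map whose fibres are the orbits of a group of isometries. -/
structure IsOrbitMap {E Y : Type*} [NormedAddCommGroup E] [NormedSpace ℝ E] [TopologicalSpace Y]
    (G : Subgroup (E ≃ₗᵢ[ℝ] E)) (q : C(E, Y)) : Prop where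
  isOpenMap : IsOpenMap q
  eq_iff : ∀ x y, q x = q y ↔ ∃ g : G, g.1 x = y

namespace SingChain

lemma push_mem_within_image {X Y : Type*} [TopologicalSpace X] [TopologicalSpace Y] {q : C(X, Y)}
    {U : Set X} {a : SingChain X} (ha : a ∈ within U) : push q a ∈ within (q '' U) :=
  push_mem_within (Set.mapsTo_image q U) ha

variable {E Y : Type*} [NormedAddCommGroup E] [NormedSpace ℝ E] [TopologicalSpace Y]
  {G : Subgroup (E ≃ₗᵢ[ℝ] E)} {q : C(E, Y)}

/-- The action of an element of a group of isometries, as a continuous map. -/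
def act (g : G) : C(E, E) := ⟨g.1, g.1.continuous⟩

lemma push_act_mul (g h : G) (c : SingChain E) :
    push (act (g * h)) c = push (act g) (push (act h) c) := by
  rw [← push_comp]; rfl

variable (G) in
/-- The chains fixed by a group of isometries. -/
def invariants : Submodule ℚ (SingChain E) :=
  ⨅ g : G, LinearMap.eqLocus (push (act g)) LinearMap.id

lemma mem_invariants {c : SingChain E} : c ∈ invariants G ↔ ∀ g : G, push (act g) c = c := by
  simp [invariants, Submodule.mem_iInf]

lemma bdry_mem_invariants {c : SingChain E} (hc : c ∈ invariants G) : bdry c ∈ invariants G :=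
  mem_invariants.2 fun g => by rw [← bdry_push, mem_invariants.1 hc]

lemma component_mem_invariants (k : ℕ) {c : SingChain E} (hc : c ∈ invariants G) :
    component k c ∈ invariants G :=
  mem_invariants.2 fun g => by rw [push_component, mem_invariants.1 hc]

variable (G) in
/-- The average of the translates of a chain by a finite group. -/
def average [Fintype G] : SingChain E →ₗ[ℚ] SingChain E :=
  (Fintype.card G : ℚ)⁻¹ • ∑ g : G, push (act g)

section Average

variable [Fintype G]

lemma average_apply (c : SingChain E) :
    average G c = (Fintype.card G : ℚ)⁻¹ • ∑ g : G, push (act g) c := by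
  rw [average, LinearMap.smul_apply, LinearMap.sum_apply]

lemma inv_card_smul_sum {M : Type*} [AddCommGroup M] [Module ℚ M] (m : M) :
    (Fintype.card G : ℚ)⁻¹ • ∑ _g : G, m = m := by
  rw [Finset.sum_const, Finset.card_univ, ← Nat.cast_smul_eq_nsmul ℚ, smul_smul,
    inv_mul_cancel₀ (Nat.cast_ne_zero.2 Fintype.card_ne_zero), one_smul]

lemma average_mem_invariants (c : SingChain E) : average G c ∈ invariants G :=
  mem_invariants.2 fun g => by
    rw [average_apply, map_smul, map_sum]
    simp only [← push_act_mul]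
    rw [Fintype.sum_equiv (Equiv.mulLeft g) (fun h => push (act (g * h)) c)
      (fun h => push (act h) c) fun h => rfl]

lemma average_of_mem {c : SingChain E} (hc : c ∈ invariants G) : average G c = c := by
  rw [average_apply, Finset.sum_congr rfl fun g _ => mem_invariants.1 hc g, inv_card_smul_sum]

lemma average_push_act (g : G) (c : SingChain E) : average G (push (act g) c) = average G c := by
  rw [average_apply, average_apply]
  simp only [← push_act_mul]
  rw [Fintype.sum_equiv (Equiv.mulRight g) (fun h => push (act (h * g)) c)
    (fun h => push (act h) c) fun h => rfl]

lemma average_mem_within {U : Set E} (hU : ∀ g : G, ∀ x ∈ U, g.1 x ∈ U) {c : SingChain E}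
    (hc : c ∈ within U) : average G c ∈ within U := by
  rw [average_apply]
  exact Submodule.smul_mem _ _
    (Submodule.sum_mem _ fun g _ => push_mem_within (fun x hx => hU g x hx) hc)

lemma bdry_average (c : SingChain E) : bdry (average G c) = average G (bdry c) := by
  rw [average_apply, average_apply, map_smul, map_sum]
  simp only [bdry_push]

lemma component_average (k : ℕ) (c : SingChain E) :
    component k (average G c) = average G (component k c) := by
  rw [average_apply, average_apply, map_smul, map_sum]
  simp only [push_component]

@[simp] lemma average_empty : average G (empty E) = empty E := by
  rw [average_apply]
  simp only [push_empty]
  exact inv_card_smul_sum _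

lemma push_average (hq : IsOrbitMap G q) (c : SingChain E) : push q (average G c) = push q c := by
  rw [average_apply, map_smul, map_sum]
  have : ∀ g : G, push q (push (act g) c) = push q c := fun g => by
    rw [← push_comp]
    congr 2
    ext x
    exact ((hq.eq_iff _ _).2 ⟨g, rfl⟩).symm
  simp only [this]
  exact inv_card_smul_sum _

end Average

variable (G q) in
/-- The mapping cone of the map from invariant chains in `U` to chains in `q '' U` is acyclic. -/
def ConeAcyclic (U : Set E) : Prop :=
  ∀ a ∈ within U, a ∈ invariants G → ∀ b ∈ within (q '' U), bdry a = 0 → push q a = bdry b →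
    ∃ a' ∈ within U, a' ∈ invariants G ∧ ∃ b' ∈ within (q '' U),
      bdry a' = a ∧ b = push q a' + bdry b'

lemma image_inter_of_isOrbitMap (hq : IsOrbitMap G q) {U V : Set E}
    (hV : ∀ g : G, ∀ x ∈ V, g.1 x ∈ V) : q '' (U ∩ V) = q '' U ∩ q '' V := by
  refine (Set.image_inter_subset _ _ _).antisymm ?_
  rintro _ ⟨⟨x, hx, rfl⟩, y, hy, hxy⟩
  obtain ⟨g, rfl⟩ := (hq.eq_iff _ _).1 hxy
  exact ⟨_, ⟨hx, hV g y hy⟩, rfl⟩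

lemma ConeAcyclic.of_iterate_sd {U : Set E} (r : ℕ) {a : SingChain E} {b : SingChain Y}
    (ha : a ∈ within U) (hai : a ∈ invariants G) (hb : b ∈ within (q '' U)) (h0 : bdry a = 0)
    (hab : push q a = bdry b)
    (h : ∃ a' ∈ within U, a' ∈ invariants G ∧ ∃ b' ∈ within (q '' U),
      bdry a' = sd^[r] a ∧ sd^[r] b = push q a' + bdry b') :
    ∃ a' ∈ within U, a' ∈ invariants G ∧ ∃ b' ∈ within (q '' U),
      bdry a' = a ∧ b = push q a' + bdry b' := by
  obtain ⟨a', ha', hai', b', hb', h1, h2⟩ := h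
  have hTa := bdry_sdHomotopyIter r a
  have hTb := bdry_sdHomotopyIter r b
  rw [h0, map_zero, add_zero] at hTa
  rw [← hab, sdHomotopyIter_push] at hTb
  refine ⟨a' + sdHomotopyIter r a, Submodule.add_mem _ ha' (sdHomotopyIter_mem_within r ha),
    Submodule.add_mem _ hai' (mem_invariants.2 fun g => ?_), b' + sdHomotopyIter r b,
    Submodule.add_mem _ hb' (sdHomotopyIter_mem_within r hb), ?_, ?_⟩
  · rw [← sdHomotopyIter_push, mem_invariants.1 hai]
  · rw [map_add, h1, hTa]; abel
  · rw [map_add, map_add, ← sub_eq_iff_eq_add.2 hTb.symm, h2]; abel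

lemma iterate_sd_mem_invariants (r : ℕ) {a : SingChain E} (ha : a ∈ invariants G) :
    sd^[r] a ∈ invariants G :=
  mem_invariants.2 fun g => by rw [← iterate_sd_push, mem_invariants.1 ha]

/-- Mayer–Vietoris for the comparison of invariant chains and chains of the orbit space. -/
lemma ConeAcyclic.union [Finite G] (hq : IsOrbitMap G q) {U V : Set E} (hU : IsOpen U)
    (hV : IsOpen V) (hU' : ∀ g : G, ∀ x ∈ U, g.1 x ∈ U) (hV' : ∀ g : G, ∀ x ∈ V, g.1 x ∈ V)
    (KU : ConeAcyclic G q U) (KV : ConeAcyclic G q V) (KUV : ConeAcyclic G q (U ∩ V)) :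
    ConeAcyclic G q (U ∪ V) := by
  have := Fintype.ofFinite G
  intro a ha hai b hb h0 hab
  obtain ⟨r₁, hr₁⟩ := exists_iterate_sd_mem hU hV ha
  have hb' := hb
  rw [Set.image_union] at hb'
  obtain ⟨r₂, hr₂⟩ := exists_iterate_sd_mem (hq.isOpenMap _ hU) (hq.isOpenMap _ hV) hb'
  refine ConeAcyclic.of_iterate_sd (r₁ + r₂) ha hai hb h0 hab ?_
  have hi := iterate_sd_mem_invariants (r₁ + r₂) hai
  have hra : sd^[r₁ + r₂] a ∈ within U ⊔ within V := by
    rw [add_comm, Function.iterate_add_apply]; exact iterate_sd_mem_sup _ hr₁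
  have hrb : sd^[r₁ + r₂] b ∈ within (q '' U) ⊔ within (q '' V) := by
    rw [Function.iterate_add_apply]; exact iterate_sd_mem_sup _ hr₂
  replace h0 : bdry (sd^[r₁ + r₂] a) = 0 := by
    rw [bdry_iterate_sd, h0, ← Module.End.coe_pow, map_zero]
  replace hab : push q (sd^[r₁ + r₂] a) = bdry (sd^[r₁ + r₂] b) := by
    rw [← iterate_sd_push, hab, bdry_iterate_sd]
  obtain ⟨u, hu, v, hv, huv⟩ := Submodule.mem_sup.1 hra
  obtain ⟨bU, hbU, bV, hbV, hbUV⟩ := Submodule.mem_sup.1 hrb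
  have haUV : average G u + average G v = sd^[r₁ + r₂] a := by
    rw [← map_add, huv, average_of_mem hi]
  set aU := average G u
  set aV := average G v
  have haU : aU ∈ within U := average_mem_within hU' hu
  have haV : aV ∈ within V := average_mem_within hV' hv
  have haUi : aU ∈ invariants G := average_mem_invariants u
  have haVi : aV ∈ invariants G := average_mem_invariants v
  rw [← haUV, ← hbUV] at hab ⊢
  rw [← haUV, map_add] at h0
  rw [map_add, map_add] at hab
  have hα : bdry aU = bdry (-aV) := by rw [map_neg]; exact eq_neg_of_add_eq_zero_left h0
  have hβ : push q aU - bdry bU = bdry bV - push q aV := by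
    rw [sub_eq_sub_iff_add_eq_add, hab, add_comm]
  obtain ⟨a₀, ha₀, hai₀, b₀, hb₀, h₁, h₂⟩ := KUV (bdry aU) (by
      rw [within_inter]
      exact ⟨bdry_mem_within haU, (hα ▸ bdry_mem_within (Submodule.neg_mem _ haV) :
        bdry aU ∈ within V)⟩)
    (bdry_mem_invariants haUi) (push q aU - bdry bU) (by
      rw [image_inter_of_isOrbitMap hq hV', within_inter]
      refine ⟨Submodule.sub_mem _ (push_mem_within_image haU) (bdry_mem_within hbU), ?_⟩
      rw [hβ]
      exact Submodule.sub_mem _ (bdry_mem_within hbV) (push_mem_within_image haV))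
    (bdry_bdry _) (by rw [map_sub, bdry_bdry, sub_zero, bdry_push])
  have h₃ := within_mono Set.inter_subset_left ha₀
  have h₄ := within_mono Set.inter_subset_right ha₀
  have h₅ := within_mono (Set.image_mono Set.inter_subset_left) hb₀
  have h₆ := within_mono (Set.image_mono Set.inter_subset_right) hb₀
  obtain ⟨a₁, ha₁, hai₁, b₁, hb₁, h₇, h₈⟩ := KU (aU - a₀) (Submodule.sub_mem _ haU h₃)
    (Submodule.sub_mem _ haUi hai₀) (bU + b₀) (Submodule.add_mem _ hbU h₅)
    (by rw [map_sub, h₁, sub_self])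
    (by rw [map_sub, map_add, sub_eq_iff_eq_add.1 h₂]; abel)
  obtain ⟨a₂, ha₂, hai₂, b₂, hb₂, h₉, h₁₀⟩ := KV (aV + a₀) (Submodule.add_mem _ haV h₄)
    (Submodule.add_mem _ haVi hai₀) (bV - b₀) (Submodule.sub_mem _ hbV h₆)
    (by rw [map_add, h₁, hα, map_neg, add_neg_cancel])
    (by
      rw [hβ] at h₂
      rw [map_add, map_sub, sub_eq_iff_eq_add.1 h₂]; abel)
  refine ⟨a₁ + a₂, Submodule.add_mem _ (within_mono Set.subset_union_left ha₁)
    (within_mono Set.subset_union_right ha₂), Submodule.add_mem _ hai₁ hai₂, b₁ + b₂,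
    Submodule.add_mem _ (within_mono (Set.image_mono Set.subset_union_left) hb₁)
      (within_mono (Set.image_mono Set.subset_union_right) hb₂), ?_, ?_⟩
  · rw [map_add, h₇, h₉]; abel
  · rw [map_add, map_add]
    have : bU + bV = (bU + b₀) + (bV - b₀) := by abel
    rw [this, h₈, h₁₀]; abel

end SingChain

/-! ### Invariant sets with convex components -/

/-- A decomposition of an invariant open set in disjoint convex open sets that are permuted by
the group. -/
structure ConvexDecomposition {E : Type*} [NormedAddCommGroup E] [NormedSpace ℝ E]
    (G : Subgroup (E ≃ₗᵢ[ℝ] E)) (U : Set E) where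
  /-- The part of the decomposition that contains a given point. -/
  part : E → Set E
  isOpen : IsOpen U
  act_mem : ∀ g : G, ∀ x ∈ U, g.1 x ∈ U
  mem_part : ∀ x ∈ U, x ∈ part x
  convex_part : ∀ x ∈ U, Convex ℝ (part x)
  isOpen_part : ∀ x ∈ U, IsOpen (part x)
  part_subset : ∀ x ∈ U, part x ⊆ U
  part_eq : ∀ x ∈ U, ∀ y ∈ part x, part y = part x
  part_act : ∀ g : G, ∀ x ∈ U, part (g.1 x) = g.1 '' part x

namespace ConvexDecomposition

variable {E Y : Type*} [NormedAddCommGroup E] [NormedSpace ℝ E] [TopologicalSpace Y]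
  {G : Subgroup (E ≃ₗᵢ[ℝ] E)} {q : C(E, Y)} {U V : Set E}

/-- The empty set has no parts. -/
def empty (G : Subgroup (E ≃ₗᵢ[ℝ] E)) : ConvexDecomposition G (∅ : Set E) where
  part _ := ∅
  isOpen := isOpen_empty
  act_mem _ _ h := h
  mem_part _ h := h
  convex_part _ _ := convex_empty
  isOpen_part _ _ := isOpen_empty
  part_subset _ _ := subset_rfl
  part_eq _ _ _ _ := rfl
  part_act _ _ _ := (Set.image_empty _).symm

/-- The intersection of two decomposed sets is decomposed by the intersections of the parts. -/
def inter (D : ConvexDecomposition G U) (D' : ConvexDecomposition G V) :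
    ConvexDecomposition G (U ∩ V) where
  part x := D.part x ∩ D'.part x
  isOpen := D.isOpen.inter D'.isOpen
  act_mem g x h := ⟨D.act_mem g x h.1, D'.act_mem g x h.2⟩
  mem_part x h := ⟨D.mem_part x h.1, D'.mem_part x h.2⟩
  convex_part x h := (D.convex_part x h.1).inter (D'.convex_part x h.2)
  isOpen_part x h := (D.isOpen_part x h.1).inter (D'.isOpen_part x h.2)
  part_subset x h := Set.inter_subset_inter (D.part_subset x h.1) (D'.part_subset x h.2)
  part_eq x h y hy := by rw [D.part_eq x h.1 y hy.1, D'.part_eq x h.2 y hy.2]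
  part_act g x h := by
    rw [D.part_act g x h.1, D'.part_act g x h.2, Set.image_inter g.1.injective]

lemma _root_.IsOrbitMap.exists_invFun_eq (hq : IsOrbitMap G q) (x : E) :
    ∃ g : G, g.1 x = Function.invFun q (q x) :=
  (hq.eq_iff _ _).1 (Function.invFun_eq ⟨x, rfl⟩).symm

open Classical in
/-- A point of a nonempty set. -/
def pointOf (C : Set E) : E := if h : C.Nonempty then h.some else 0

variable (D : ConvexDecomposition G U)
include D

/-- A point of the part of `x`, which depends on the part only. -/
def base (x : E) : E := pointOf (D.part x)

lemma base_mem {x : E} (hx : x ∈ U) : D.base x ∈ D.part x := by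
  have h : (D.part x).Nonempty := ⟨x, D.mem_part x hx⟩
  rw [base, pointOf, dif_pos h]
  exact h.some_mem

lemma base_eq {x y : E} (h : D.part y = D.part x) : D.base y = D.base x :=
  congrArg pointOf h

variable [Fintype G]

/-- A point of the part of `x` fixed by the stabilizer of the part, chosen equivariantly. -/
def center (x : E) : E := (Fintype.card G : ℝ)⁻¹ • ∑ g : G, g.1.symm (D.base (g.1 x))

lemma center_act (h : G) (x : E) : D.center (h.1 x) = h.1 (D.center x) := by
  rw [center, center, map_smul, map_sum]
  congr 1
  refine Fintype.sum_equiv (Equiv.mulRight h) _ _ fun g => ?_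
  change _ = h.1 ((g * h).1⁻¹ (D.base (g.1 (h.1 x))))
  rw [Subgroup.coe_mul, mul_inv_rev]
  exact (h.1.apply_symm_apply _).symm

lemma center_mem {x : E} (hx : x ∈ U) : D.center x ∈ D.part x := by
  rw [center, Finset.smul_sum]
  refine (D.convex_part x hx).sum_mem (fun _ _ => by positivity) ?_ fun g _ => ?_
  · rw [Finset.sum_const, Finset.card_univ, nsmul_eq_mul, mul_inv_cancel₀
      (Nat.cast_ne_zero.2 Fintype.card_ne_zero)]
  · have h := D.base_mem (D.act_mem g x hx)
    rw [D.part_act g x hx] at h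
    obtain ⟨z, hz, h⟩ := h
    rwa [← h, LinearIsometryEquiv.symm_apply_apply]

lemma center_eq {x y : E} (hx : x ∈ U) (hy : y ∈ D.part x) : D.center y = D.center x := by
  rw [center, center]
  congr 1
  refine Finset.sum_congr rfl fun g _ => ?_
  rw [D.base_eq (x := g.1 x) (y := g.1 y)]
  rw [D.part_act g x hx, D.part_act g y (D.part_subset x hx hy), D.part_eq x hx y hy]

lemma eventually_center_eq {x : E} (hx : x ∈ U) : ∀ᶠ y in nhds x, D.center y = D.center x := by
  filter_upwards [(D.isOpen_part x hx).mem_nhds (D.mem_part x hx)] with y hy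
  exact D.center_eq hx hy

/-- The equivariant deformation of a decomposed set to the centers of its parts. -/
def contraction : LocalContraction U where
  H s x := (1 - (s : ℝ)) • x + (s : ℝ) • D.center x
  continuousOn := by
    have h : ContinuousOn (fun p : unitInterval × E => D.center p.2) (Set.univ ×ˢ U) := by
      refine ContinuousOn.comp (g := D.center) (t := U) (fun x hx => ?_) continuousOn_snd
        fun p hp => hp.2
      exact (continuousAt_const.congr ((D.eventually_center_eq hx).mono
        fun y hy => hy.symm)).continuousWithinAt
    fun_prop
  zero x _ := by simp
  mem s x hx := D.part_subset x hx (D.convex_part x hx (D.mem_part x hx) (D.center_mem hx)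
    (sub_nonneg.2 s.2.2) s.2.1 (by ring))
  locallyConstant x hx := by
    refine nhdsWithin_le_nhds ((D.eventually_center_eq hx).mono fun y hy => ?_)
    simp [hy]

lemma contraction_one (x : E) : D.contraction.H 1 x = D.center x := by
  change (1 - ((1 : unitInterval) : ℝ)) • x + ((1 : unitInterval) : ℝ) • D.center x = _
  simp

lemma contraction_act (s : unitInterval) (g : G) (x : E) :
    D.contraction.H s (g.1 x) = g.1 (D.contraction.H s x) := by
  change (1 - (s : ℝ)) • g.1 x + (s : ℝ) • D.center (g.1 x) =
    g.1 ((1 - (s : ℝ)) • x + (s : ℝ) • D.center x)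
  rw [center_act, map_add, map_smul, map_smul]

lemma map_contraction_invFun (hq : IsOrbitMap G q) (s : unitInterval) (x : E) :
    q (D.contraction.H s (Function.invFun q (q x))) = q (D.contraction.H s x) := by
  obtain ⟨g, hg⟩ := hq.exists_invFun_eq x
  rw [← hg, contraction_act]
  exact ((hq.eq_iff _ _).2 ⟨g, rfl⟩).symm

/-- The deformation of the orbit space of a decomposed set. -/
def contractionImage (hq : IsOrbitMap G q) : LocalContraction (q '' U) where
  H s y := q (D.contraction.H s (Function.invFun q y))
  continuousOn := by
    rintro ⟨s, _⟩ ⟨-, x, hx, rfl⟩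
    refine ContinuousAt.continuousWithinAt ?_
    have ho : IsOpenMap (Prod.map id q : unitInterval × E → unitInterval × Y) :=
      IsOpenMap.id.prodMap hq.isOpenMap
    have hc : Continuous (Prod.map id q : unitInterval × E → unitInterval × Y) := by fun_prop
    have h := ho.map_nhds_eq hc.continuousAt (x := (s, x))
    change Filter.Tendsto _ (nhds (Prod.map id q (s, x))) _
    rw [← h, Filter.tendsto_map'_iff]
    have h1 : (fun p : unitInterval × Y => q (D.contraction.H p.1 (Function.invFun q p.2))) ∘
        Prod.map id q = fun p : unitInterval × E => q (D.contraction.H p.1 p.2) :=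
      funext fun p => D.map_contraction_invFun hq p.1 p.2
    rw [h1]
    change Filter.Tendsto _ _ (nhds (q (D.contraction.H s (Function.invFun q (q x)))))
    rw [D.map_contraction_invFun hq]
    exact (q.continuous.continuousAt.comp (D.contraction.continuousOn.continuousAt
      ((isOpen_univ.prod D.isOpen).mem_nhds (Set.mk_mem_prod trivial hx))) :)
  zero := by
    rintro _ ⟨x, hx, rfl⟩
    rw [D.map_contraction_invFun hq, D.contraction.zero x hx]
  mem := by
    rintro s _ ⟨x, hx, rfl⟩
    rw [D.map_contraction_invFun hq]
    exact ⟨_, D.contraction.mem s x hx, rfl⟩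
  locallyConstant := by
    rintro _ ⟨x, hx, rfl⟩
    refine nhdsWithin_le_nhds ?_
    rw [← hq.isOpenMap.map_nhds_eq q.continuous.continuousAt]
    refine Filter.eventually_map.2 <| (D.eventually_center_eq hx).mono fun y hy => ?_
    rw [D.map_contraction_invFun hq, D.map_contraction_invFun hq, contraction_one, contraction_one,
      hy]

lemma contractionImage_one (hq : IsOrbitMap G q) (y : Y) :
    (D.contractionImage hq).H 1 y = q (D.center (Function.invFun q y)) := by
  rw [← contraction_one]; rfl

open SingChain

/-- The values of `lift` on simplices. -/
def liftSimplex (q : C(E, Y)) : SingSimplex Y → SingChain E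
  | ⟨0, _⟩ => SingChain.empty E
  | ⟨1, σ⟩ => average G (point (D.center (Function.invFun q (σ default))))
  | ⟨_ + 2, _⟩ => 0

/-- The lift of chains of the orbit space to averages of centers. -/
def lift (q : C(E, Y)) : SingChain Y →ₗ[ℚ] SingChain E :=
  Finsupp.linearCombination ℚ (D.liftSimplex q)

@[simp] lemma lift_empty : D.lift q (SingChain.empty Y) = SingChain.empty E := by
  simp [lift, liftSimplex, SingChain.empty]

lemma lift_single_one (σ : C(stdSimplex ℝ (Fin 1), Y)) :
    D.lift q (single σ) = average G (point (D.center (Function.invFun q (σ default)))) := by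
  simp [lift, liftSimplex]

lemma lift_single_succ_succ {k : ℕ} (σ : C(stdSimplex ℝ (Fin (k + 2)), Y)) :
    D.lift q (single σ) = 0 := by
  simp [lift, liftSimplex]

lemma lift_mem_invariants (b : SingChain Y) : D.lift q b ∈ invariants G :=
  map_mem_of_single (U := Set.univ) (fun k σ _ => by
    match k with
    | 0 => rw [single_zero_eq, lift_empty, ← average_empty (G := G)]; exact average_mem_invariants _
    | 1 => rw [lift_single_one]; exact average_mem_invariants _
    | k + 2 => rw [lift_single_succ_succ]; exact Submodule.zero_mem _) (mem_within_univ b)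

lemma lift_mem_within (hq : IsOrbitMap G q) {b : SingChain Y} (hb : b ∈ within (q '' U)) :
    D.lift q b ∈ within U :=
  map_mem_of_single (fun k σ h => by
    match k with
    | 0 => rw [single_zero_eq, lift_empty]; exact empty_mem_within _
    | 1 =>
      rw [lift_single_one]
      refine average_mem_within D.act_mem (point_mem_within ?_)
      obtain ⟨x, hx, hxy⟩ := h ⟨default, rfl⟩
      obtain ⟨g, hg⟩ := hq.exists_invFun_eq x
      rw [← hxy, ← hg]
      have := D.act_mem g x hx
      exact D.part_subset _ this (D.center_mem this)
    | k + 2 => rw [lift_single_succ_succ]; exact Submodule.zero_mem _) hb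

omit D in
lemma _root_.IsOrbitMap.average_point_eq (hq : IsOrbitMap G q) {x y : E} (h : q x = q y) :
    average G (point x) = average G (point y) := by
  obtain ⟨g, rfl⟩ := (hq.eq_iff _ _).1 h
  rw [← average_push_act g, push_point]
  rfl

lemma bdry_lift (hq : IsOrbitMap G q) {b : SingChain Y} (hb : b ∈ within (q '' U)) :
    bdry (D.lift q b) = D.lift q (bdry b) := by
  refine eqOn_within (f := bdry ∘ₗ D.lift q) (g := D.lift q ∘ₗ bdry) (fun k σ h => ?_) hb
  rw [LinearMap.comp_apply, LinearMap.comp_apply]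
  match k with
  | 0 => rw [single_zero_eq, lift_empty, bdry_empty, bdry_empty, map_zero]
  | 1 => rw [lift_single_one, bdry_average, bdry_point, bdry_single_one, lift_empty, average_empty]
  | 2 =>
    rw [lift_single_succ_succ, bdry_single_succ, Fin.sum_univ_two, map_add, map_smul, map_smul,
      lift_single_one, lift_single_one]
    rw [hq.average_point_eq (x := D.center (Function.invFun q ((σ.comp (simplexFace 0)) default)))
      (y := D.center (Function.invFun q ((σ.comp (simplexFace 1)) default)))]
    · simp
    · rw [← contractionImage_one D hq, ← contractionImage_one D hq]
      exact (D.contractionImage hq).end_eq h _ _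
  | k + 3 =>
    rw [lift_single_succ_succ, bdry_single_succ, map_sum, map_zero]
    refine (Finset.sum_eq_zero fun i _ => ?_).symm
    rw [map_smul, lift_single_succ_succ, smul_zero]

lemma push_lift (hq : IsOrbitMap G q) {b : SingChain Y} (hb : b ∈ within (q '' U)) :
    bdry ((D.contractionImage hq).cone b) + (D.contractionImage hq).cone (bdry b) =
      b - push q (D.lift q b) := by
  refine eqOn_within (f := bdry ∘ₗ (D.contractionImage hq).cone +
    (D.contractionImage hq).cone ∘ₗ bdry) (g := LinearMap.id - push q ∘ₗ D.lift q)
    (fun k σ h => ?_) hb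
  rw [LinearMap.add_apply, LinearMap.sub_apply, LinearMap.comp_apply, LinearMap.comp_apply,
    LinearMap.comp_apply, LinearMap.id_apply]
  match k with
  | 0 =>
    rw [LocalContraction.cone_single_zero, bdry_single_zero, single_zero_eq, lift_empty,
      push_empty, map_zero, map_zero, sub_self, add_zero]
  | 1 =>
    rw [LocalContraction.bdry_cone_single_one _ _ h, bdry_single_one, LocalContraction.cone_empty,
      lift_single_one, push_average hq, push_point, contractionImage_one, add_zero]
  | k + 2 =>
    rw [LocalContraction.bdry_cone_single_succ_succ _ _ h, lift_single_succ_succ, map_zero,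
      sub_zero]

lemma lift_push (hq : IsOrbitMap G q) {a : SingChain E} (ha : a ∈ within U) :
    average G (bdry (D.contraction.cone a) + D.contraction.cone (bdry a)) =
      average G a - D.lift q (push q a) := by
  refine eqOn_within (f := average G ∘ₗ (bdry ∘ₗ D.contraction.cone + D.contraction.cone ∘ₗ bdry))
    (g := average G - D.lift q ∘ₗ push q) (fun k σ h => ?_) ha
  rw [LinearMap.comp_apply, LinearMap.add_apply, LinearMap.sub_apply, LinearMap.comp_apply,
    LinearMap.comp_apply, LinearMap.comp_apply, push_single]
  match k with
  | 0 =>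
    rw [LocalContraction.cone_single_zero, bdry_single_zero, single_zero_eq, single_zero_eq,
      lift_empty, average_empty, map_zero, map_zero, add_zero, map_zero, sub_self]
  | 1 =>
    rw [LocalContraction.bdry_cone_single_one _ _ h, bdry_single_one, LocalContraction.cone_empty,
      lift_single_one, add_zero, map_sub, contraction_one]
    congr 1
    obtain ⟨g, hg⟩ := hq.exists_invFun_eq (σ default)
    rw [ContinuousMap.comp_apply, ← hg, center_act]
    exact hq.average_point_eq ((hq.eq_iff _ _).2 ⟨g, rfl⟩)
  | k + 2 =>
    rw [LocalContraction.bdry_cone_single_succ_succ _ _ h, lift_single_succ_succ, sub_zero]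

/-- On a set with convex parts, invariant chains compute the homology of the orbit space. -/
lemma coneAcyclic (hq : IsOrbitMap G q) : ConeAcyclic G q U := by
  intro a ha hai b hb h0 hab
  have hcone : D.contraction.cone a ∈ invariants G := mem_invariants.2 fun g => by
    rw [D.contraction.push_cone D.contraction (fun x hx => D.act_mem g x hx)
      (fun s x _ => (D.contraction_act s g x).symm) ha, mem_invariants.1 hai]
  have h1 := D.lift_push hq ha
  rw [h0, map_zero, add_zero, average_of_mem (bdry_mem_invariants hcone), average_of_mem hai, hab,
    ← D.bdry_lift hq hb] at h1
  have h2 := D.push_lift hq hb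
  rw [← hab, ← D.contraction.push_cone (D.contractionImage hq) (Set.mapsTo_image q U)
    (fun s x _ => (D.map_contraction_invFun hq s x).symm) ha] at h2
  refine ⟨D.contraction.cone a + D.lift q b, Submodule.add_mem _ (D.contraction.cone_mem_within ha)
    (D.lift_mem_within hq hb), Submodule.add_mem _ hcone (D.lift_mem_invariants b),
    (D.contractionImage hq).cone b, LocalContraction.cone_mem_within _ hb, ?_, ?_⟩
  · rw [map_add, h1]; abel
  · rw [map_add]
    exact (eq_sub_iff_add_eq.1 h2).symm.trans (by abel)

end ConvexDecomposition

/-! ### Comparison of the homology of the punctured space and of its orbit space -/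

namespace SingChain

section Cones

variable {E : Type*} [NormedAddCommGroup E] [NormedSpace ℝ E]

/-- The open convex cone over the ball of radius `ε` around `p`. -/
def openCone (ε : ℝ) (p : E) : ConvexCone ℝ E := ConvexCone.hull ℝ (Metric.ball p ε)

lemma mem_openCone {ε : ℝ} {p z : E} : z ∈ openCone ε p ↔ ∃ t : ℝ, 0 < t ∧ ‖t • z - p‖ < ε := by
  rw [openCone, ConvexCone.mem_hull_of_convex (convex_ball p ε)]
  constructor
  · rintro ⟨t, ht, h⟩
    rw [Set.mem_smul_set_iff_inv_smul_mem₀ ht.ne', mem_ball_iff_norm] at h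
    exact ⟨t⁻¹, inv_pos.2 ht, h⟩
  · rintro ⟨t, ht, h⟩
    refine ⟨t⁻¹, inv_pos.2 ht, ?_⟩
    rwa [Set.mem_smul_set_iff_inv_smul_mem₀ (inv_pos.2 ht).ne', inv_inv, mem_ball_iff_norm]

lemma isOpen_openCone (ε : ℝ) (p : E) : IsOpen (openCone ε p : Set E) := by
  have : (openCone ε p : Set E) = ⋃ t : ℝ, ⋃ _ : 0 < t, {z | ‖t • z - p‖ < ε} := by
    ext z; simp [mem_openCone]
  rw [this]
  exact isOpen_iUnion fun t => isOpen_iUnion fun _ => isOpen_lt (by fun_prop) continuous_const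

lemma act_mem_openCone (g : E ≃ₗᵢ[ℝ] E) {ε : ℝ} {p z : E} :
    g z ∈ openCone ε (g p) ↔ z ∈ openCone ε p := by
  simp only [mem_openCone, ← map_smul, ← map_sub, LinearIsometryEquiv.norm_map]

lemma norm_sub_lt_of_mem_openCone {ε : ℝ} {p p' z : E} (hp : ‖p‖ = ‖p'‖)
    (hz : z ∈ openCone ε p) (hz' : z ∈ openCone ε p') : ‖p - p'‖ < 4 * ε := by
  obtain ⟨t, ht, h⟩ := mem_openCone.1 hz
  obtain ⟨s, hs, h'⟩ := mem_openCone.1 hz'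
  have h1 := (abs_norm_sub_norm_le (t • z) p).trans_lt h
  have h2 := (abs_norm_sub_norm_le (s • z) p').trans_lt h'
  rw [norm_smul, Real.norm_of_nonneg ht.le, abs_lt] at h1
  rw [norm_smul, Real.norm_of_nonneg hs.le, abs_lt] at h2
  have h3 : ‖t • z - s • z‖ < 2 * ε := by
    rw [← sub_smul, norm_smul, Real.norm_eq_abs, ← abs_of_nonneg (norm_nonneg z), ← abs_mul,
      abs_lt, sub_mul]
    constructor <;> linarith
  have h4 : p - p' = -(t • z - p) + (t • z - s • z) + (s • z - p') := by abel
  rw [h4]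
  refine (norm_add₃_le).trans_lt ?_
  rw [norm_neg]
  linarith

variable {G : Subgroup (E ≃ₗᵢ[ℝ] E)}

/-- The union of the cones around the points of an orbit. -/
def orbitCone (G : Subgroup (E ≃ₗᵢ[ℝ] E)) (ε : ℝ) (p : E) : Set E :=
  {z | ∃ g : G, z ∈ openCone ε (g.1 p)}

lemma mem_orbitCone_self {ε : ℝ} (hε : 0 < ε) (p : E) : p ∈ orbitCone G ε p :=
  ⟨1, mem_openCone.2 ⟨1, one_pos, by simpa using hε⟩⟩

lemma zero_notMem_orbitCone {ε : ℝ} {p : E} (h : ε ≤ ‖p‖) : (0 : E) ∉ orbitCone G ε p := by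
  rintro ⟨g, hg⟩
  obtain ⟨t, -, ht⟩ := mem_openCone.1 hg
  rw [smul_zero, zero_sub, norm_neg, LinearIsometryEquiv.norm_map] at ht
  exact ht.not_ge h

lemma smul_mem_orbitCone {ε t : ℝ} (ht : 0 < t) {p z : E} (hz : z ∈ orbitCone G ε p) :
    t • z ∈ orbitCone G ε p :=
  hz.imp fun _ hg => ConvexCone.smul_mem _ ht hg

lemma isOpen_orbitCone (ε : ℝ) (p : E) : IsOpen (orbitCone G ε p) := by
  have : orbitCone G ε p = ⋃ g : G, openCone ε (g.1 p) := by ext; simp [orbitCone]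
  rw [this]
  exact isOpen_iUnion fun g => isOpen_openCone _ _

/-- The decomposition of a union of thin cones. -/
def orbitConeDecomposition {ε : ℝ} {p : E} (hε : ∀ g : G, g.1 p ≠ p → 4 * ε ≤ ‖g.1 p - p‖) :
    ConvexDecomposition G (orbitCone G ε p) :=
  have key : ∀ (g h : G) (z : E), z ∈ openCone ε (g.1 p) → z ∈ openCone ε (h.1 p) →
      g.1 p = h.1 p := fun g h z hg hh => by
    by_contra hne
    have h1 := norm_sub_lt_of_mem_openCone (by simp) hg hh
    have h2 : (h⁻¹ * g : G).1 p - p = h.1.symm (g.1 p - h.1 p) := by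
      rw [map_sub, LinearIsometryEquiv.symm_apply_apply]; rfl
    refine (hε (h⁻¹ * g) fun h3 => hne ?_).not_gt (by rwa [h2, LinearIsometryEquiv.norm_map])
    rw [h3, sub_self] at h2
    exact sub_eq_zero.1 ((LinearIsometryEquiv.map_eq_zero_iff _).1 h2.symm)
  have part : ∀ (g : G) (y : E), y ∈ openCone ε (g.1 p) →
      {z | ∃ h : G, y ∈ openCone ε (h.1 p) ∧ z ∈ openCone ε (h.1 p)} = openCone ε (g.1 p) :=
    fun g y hy => Set.ext fun z =>
      ⟨fun ⟨h, h1, h2⟩ => by rwa [key g h y hy h1], fun hz => ⟨g, hy, hz⟩⟩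
  { part := fun y => {z | ∃ g : G, y ∈ openCone ε (g.1 p) ∧ z ∈ openCone ε (g.1 p)}
    isOpen := isOpen_orbitCone ε p
    act_mem := fun g _ ⟨h, hx⟩ => ⟨g * h, (act_mem_openCone g.1).2 hx⟩
    mem_part := fun _ ⟨g, hx⟩ => ⟨g, hx, hx⟩
    convex_part := fun x ⟨g, hx⟩ => by rw [part g x hx]; exact ConvexCone.convex _
    isOpen_part := fun x ⟨g, hx⟩ => by rw [part g x hx]; exact isOpen_openCone _ _
    part_subset := fun _ _ _ ⟨g, _, hy⟩ => ⟨g, hy⟩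
    part_eq := fun x ⟨g, hx⟩ y hy => by
      rw [part g x hx] at hy ⊢
      exact part g y hy
    part_act := fun g x ⟨h, hx⟩ => by
      rw [part h x hx, part (g * h) (g.1 x) ((act_mem_openCone g.1).2 hx)]
      ext z
      constructor
      · intro hz
        refine ⟨g.1.symm z, (act_mem_openCone g.1).1 ?_, g.1.apply_symm_apply z⟩
        rw [g.1.apply_symm_apply]
        exact hz
      · rintro ⟨w, hw, rfl⟩
        exact (act_mem_openCone g.1).2 hw }

lemma exists_convexDecomposition [Finite G] {p : E} (hp : p ≠ 0) :
    ∃ ε : ℝ, 0 < ε ∧ ε ≤ ‖p‖ ∧ Nonempty (ConvexDecomposition G (orbitCone G ε p)) := by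
  have h1 : ∀ c : ℝ, 0 < c → ∀ᶠ ε in nhdsWithin (0 : ℝ) (Set.Ioi 0), 4 * ε ≤ c := fun c hc => by
    filter_upwards [Ioo_mem_nhdsGT (show (0 : ℝ) < c / 4 by positivity)] with ε h
    linarith [h.2]
  have h2 : ∀ᶠ ε in nhdsWithin (0 : ℝ) (Set.Ioi 0), ∀ g : G, g.1 p ≠ p → 4 * ε ≤ ‖g.1 p - p‖ :=
    Filter.eventually_all.2 fun g => by
      by_cases h : g.1 p = p
      · exact Filter.Eventually.of_forall fun _ h' => (h' h).elim
      · exact (h1 _ (norm_pos_iff.2 (sub_ne_zero.2 h))).mono fun _ h' _ => h'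
  obtain ⟨ε, h3, h4, h5 : 0 < ε⟩ :=
    (h2.and ((h1 _ (norm_pos_iff.2 hp)).and self_mem_nhdsWithin)).exists
  exact ⟨ε, h5, by linarith, ⟨orbitConeDecomposition h3⟩⟩

variable {Y : Type*} [TopologicalSpace Y] {q : C(E, Y)}

lemma coneAcyclic_biUnion [Finite G] (hq : IsOrbitMap G q) {ι : Type*} (s : Finset ι) :
    ∀ f : ι → Set E, (∀ i ∈ s, Nonempty (ConvexDecomposition G (f i))) →
      ConeAcyclic G q (⋃ i ∈ s, f i) := by
  classical
  have := Fintype.ofFinite G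
  induction s using Finset.induction_on with
  | empty =>
    intro f _
    simpa using (ConvexDecomposition.empty G).coneAcyclic hq
  | insert j s hj ih =>
    intro f hf
    obtain ⟨D⟩ := hf j (Finset.mem_insert_self _ _)
    have hs : ∀ i ∈ s, Nonempty (ConvexDecomposition G (f i)) := fun i hi =>
      hf i (Finset.mem_insert_of_mem hi)
    rw [Finset.set_biUnion_insert]
    refine ConeAcyclic.union hq D.isOpen (isOpen_biUnion fun i hi => (hs i hi).some.isOpen)
      D.act_mem ?_ (D.coneAcyclic hq) (ih f hs) ?_
    · intro g x hx
      obtain ⟨i, hi, hx⟩ := Set.mem_iUnion₂.1 hx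
      exact Set.mem_iUnion₂.2 ⟨i, hi, (hs i hi).some.act_mem g x hx⟩
    · rw [Set.inter_iUnion₂]
      exact ih _ fun i hi => ⟨D.inter (hs i hi).some⟩

/-- Away from the origin, invariant chains compute the homology of the orbit space. -/
lemma coneAcyclic_compl_zero [ProperSpace E] [Finite G] (hq : IsOrbitMap G q) :
    ConeAcyclic G q ({0}ᶜ : Set E) := by
  have hne : ∀ p : Metric.sphere (0 : E) 1, p.1 ≠ 0 := fun p => ne_zero_of_mem_unit_sphere p
  choose ε h1 h2 h3 using fun p : Metric.sphere (0 : E) 1 =>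
    exists_convexDecomposition (G := G) (hne p)
  obtain ⟨s, hs⟩ := (isCompact_sphere (0 : E) 1).elim_finite_subcover
    (fun p : Metric.sphere (0 : E) 1 => orbitCone G (ε p) p.1)
    (fun p => isOpen_orbitCone _ _)
    fun p hp => Set.mem_iUnion.2 ⟨⟨p, hp⟩, mem_orbitCone_self (h1 _) _⟩
  have : ({0}ᶜ : Set E) = ⋃ p ∈ s, orbitCone G (ε p) p.1 := by
    ext x
    rw [Set.mem_compl_singleton_iff]
    constructor
    · intro hx
      have hx' : 0 < ‖x‖ := norm_pos_iff.2 hx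
      have : ‖x‖⁻¹ • x ∈ Metric.sphere (0 : E) 1 := by
        rw [mem_sphere_zero_iff_norm, norm_smul, norm_inv, norm_norm, inv_mul_cancel₀ hx'.ne']
      obtain ⟨p, hp, h⟩ := Set.mem_iUnion₂.1 (hs this)
      have := smul_mem_orbitCone hx' h
      rw [smul_smul, mul_inv_cancel₀ hx'.ne', one_smul] at this
      exact Set.mem_iUnion₂.2 ⟨p, hp, this⟩
    · rintro hx rfl
      obtain ⟨p, hp, h⟩ := Set.mem_iUnion₂.1 hx
      exact zero_notMem_orbitCone (h2 p) h
  rw [this]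
  exact coneAcyclic_biUnion hq s _ fun p _ => h3 p

end Cones

section Transfer

variable {E Y : Type*} [NormedAddCommGroup E] [NormedSpace ℝ E] [TopologicalSpace Y]
  {G : Subgroup (E ≃ₗᵢ[ℝ] E)} {q : C(E, Y)} {U : Set E}

/-- If the group acts trivially on the homology of an invariant set on which invariant chains
compute the homology of the orbit space, then the homology does not change. -/
lemma ConeAcyclic.nonempty_homology_equiv [Finite G] (hU : ∀ g : G, ∀ x ∈ U, g.1 x ∈ U)
    (K : ConeAcyclic G q U) (k : ℕ)
    (htriv : ∀ g : G, ∀ z ∈ cycles U k, push (act g) z - z ∈ boundaries U k) :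
    Nonempty (Homology U k ≃ₗ[ℚ] Homology (q '' U) k) := by
  have := Fintype.ofFinite G
  have hpush : ∀ (z : SingChain E), z ∈ ofDegree E k → push q z ∈ ofDegree Y k := fun z hz => by
    rw [← component_of_mem hz, push_component]
    exact component_mem_ofDegree _ _
  refine SingChain.nonempty_homology_equiv (invariants G ⊓ cycles U k) LinearMap.id (push q)
    (fun m hm => hm.2) ?_ ?_ ?_ ?_
  · rintro m ⟨-, hm⟩
    obtain ⟨h1, h2, h3⟩ := mem_cycles.1 hm
    exact mem_cycles.2 ⟨push_mem_within_image h1, hpush _ h2, by rw [bdry_push, h3, map_zero]⟩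
  · intro z hz
    obtain ⟨h1, h2, h3⟩ := mem_cycles.1 hz
    refine ⟨average G z,
      ⟨average_mem_invariants z, mem_cycles.2 ⟨average_mem_within hU h1, ?_, ?_⟩⟩,
      ?_⟩
    · rw [← component_of_mem h2, ← component_average]
      exact component_mem_ofDegree _ _
    · rw [bdry_average, h3, map_zero]
    · have : average G z - z = (Fintype.card G : ℚ)⁻¹ • ∑ g : G, (push (act g) z - z) := by
        rw [Finset.sum_sub_distrib, smul_sub, inv_card_smul_sum, average_apply]
      rw [LinearMap.id_apply, this]
      exact Submodule.smul_mem _ _ (Submodule.sum_mem _ fun g _ => htriv g z hz)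
  · intro z hz
    obtain ⟨h1, h2, h3⟩ := mem_cycles.1 hz
    obtain ⟨a, ha, hai, b, hb, h4, h5⟩ := K 0 (Submodule.zero_mem _) (Submodule.zero_mem _) z h1
      (map_zero _) (by rw [h3, map_zero])
    refine ⟨component k a, ⟨component_mem_invariants k hai, mem_cycles.2
      ⟨component_mem_within k ha, component_mem_ofDegree k a, ?_⟩⟩, ?_⟩
    · cases k with
      | zero => exact bdry_component_zero _
      | succ k => rw [bdry_component_succ, h4, map_zero]
    · have : push q (component k a) - z = bdry (-component (k + 1) b) := by
        rw [map_neg, bdry_component_succ, push_component, ← component_of_mem h2, h5, map_add]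
        abel
      rw [this]
      refine bdry_mem_boundaries (Submodule.neg_mem _ (component_mem_within _ hb))
        (bdry_mem_ofDegree (Submodule.neg_mem _ (component_mem_ofDegree _ _)))
  · rintro m ⟨hmi, hm⟩
    obtain ⟨h1, h2, h3⟩ := mem_cycles.1 hm
    rw [LinearMap.id_apply]
    constructor
    · intro h
      obtain ⟨w, hw, -, rfl⟩ := exists_of_mem_boundaries h
      rw [← bdry_push]
      refine bdry_mem_boundaries (push_mem_within_image hw) ?_
      rw [bdry_push]
      exact hpush _ h2
    · intro h
      obtain ⟨w, hw, -, hmw⟩ := exists_of_mem_boundaries h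
      obtain ⟨a, ha, -, -, -, rfl, -⟩ := K m h1 hmi w hw h3 hmw.symm
      exact bdry_mem_boundaries ha h2

end Transfer

end SingChain

/-! ### Rotations act trivially on the homology of the punctured space -/

namespace SingChain

section Rotation

variable {E : Type*} [NormedAddCommGroup E] [InnerProductSpace ℝ E]

/-- A linear isometry as a continuous map. -/
def isometryMap (g : E ≃ₗᵢ[ℝ] E) : C(E, E) := ⟨g, g.continuous⟩

lemma push_isometryMap_mul (g h : E ≃ₗᵢ[ℝ] E) (c : SingChain E) :
    push (isometryMap (g * h)) c = push (isometryMap g) (push (isometryMap h) c) := by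
  rw [← push_comp]; rfl

lemma push_isometryMap_one (c : SingChain E) : push (isometryMap (1 : E ≃ₗᵢ[ℝ] E)) c = c :=
  push_id c

lemma mapsTo_isometryMap (g : E ≃ₗᵢ[ℝ] E) : Set.MapsTo (isometryMap g) {0}ᶜ {0}ᶜ :=
  fun _ hx h => hx ((g.map_eq_zero_iff).1 h)

variable {k : ℕ}

lemma push_isometryMap_mem_cycles (g : E ≃ₗᵢ[ℝ] E) {z : SingChain E}
    (hz : z ∈ cycles ({0}ᶜ : Set E) k) : push (isometryMap g) z ∈ cycles ({0}ᶜ : Set E) k := by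
  obtain ⟨h1, h2, h3⟩ := mem_cycles.1 hz
  refine mem_cycles.2 ⟨push_mem_within (mapsTo_isometryMap g) h1, ?_,
    by rw [bdry_push, h3, map_zero]⟩
  rw [← component_of_mem h2, push_component]
  exact component_mem_ofDegree _ _

lemma push_isometryMap_mem_boundaries (g : E ≃ₗᵢ[ℝ] E) {z : SingChain E}
    (hz : z ∈ boundaries ({0}ᶜ : Set E) k) :
    push (isometryMap g) z ∈ boundaries ({0}ᶜ : Set E) k := by
  obtain ⟨w, h1, h2, rfl⟩ := exists_of_mem_boundaries hz
  rw [← bdry_push]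
  refine bdry_mem_boundaries (push_mem_within (mapsTo_isometryMap g) h1) ?_
  rw [bdry_push, ← component_of_mem (bdry_mem_ofDegree h2), push_component]
  exact component_mem_ofDegree _ _

/-- The reflection in the hyperplane orthogonal to a vector. -/
abbrev hyperplaneReflection (v : E) : E ≃ₗᵢ[ℝ] E := (ℝ ∙ v)ᗮ.reflection

lemma hyperplaneReflection_apply (v x : E) :
    hyperplaneReflection v x = x - (2 * (inner ℝ v x / ‖v‖ ^ 2)) • v := by
  rw [hyperplaneReflection, Submodule.reflection_orthogonal_apply,
    Submodule.reflection_singleton_apply, mul_smul, two_smul, two_smul]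
  simp

lemma hyperplaneReflection_neg (v : E) : hyperplaneReflection (-v) = hyperplaneReflection v := by
  ext x
  rw [hyperplaneReflection_apply (-v), hyperplaneReflection_apply v, inner_neg_left, norm_neg,
    smul_neg, neg_div, mul_neg, neg_smul, neg_neg]

lemma hyperplaneReflection_mul_self (v : E) :
    hyperplaneReflection v * hyperplaneReflection v = 1 := by
  refine LinearIsometryEquiv.ext fun x => ?_
  change hyperplaneReflection v (hyperplaneReflection v x) = x
  exact Submodule.reflection_reflection (ℝ ∙ v)ᗮ x

lemma push_hyperplaneReflection_sub_mem_of_inner_nonneg {u v : E} (hu : u ≠ 0) (hv : v ≠ 0)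
    (huv : 0 ≤ inner ℝ v u) {z : SingChain E} (hz : z ∈ cycles ({0}ᶜ : Set E) k) :
    push (isometryMap (hyperplaneReflection u)) z - push (isometryMap (hyperplaneReflection v)) z ∈
      boundaries ({0}ᶜ : Set E) k := by
  let γ : unitInterval → E := fun s => (1 - (s : ℝ)) • v + (s : ℝ) • u
  have hγ : ∀ s, γ s ≠ 0 := fun s h => by
    have h1 : inner ℝ v (γ s) = 0 := by rw [h, inner_zero_right]
    have hs := sub_nonneg.2 s.2.2
    have hv' : 0 < inner ℝ v v := real_inner_self_pos.2 hv
    simp only [γ, inner_add_right, inner_smul_right] at h1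
    rcases hs.eq_or_lt with hs | hs
    · simp only [γ, ← hs, zero_smul, zero_add] at h
      rw [show (s : ℝ) = 1 by linarith, one_smul] at h
      exact hu h
    · have := mul_pos hs hv'
      have := mul_nonneg s.2.1 huv
      linarith
  have hγc : Continuous γ := by fun_prop
  let F : C(unitInterval × E, E) := ⟨fun p => hyperplaneReflection (γ p.1) p.2, by
    simp only [hyperplaneReflection_apply]
    have : ∀ p : unitInterval × E, ‖γ p.1‖ ^ 2 ≠ 0 := fun p =>
      pow_ne_zero 2 (norm_ne_zero_iff.2 (hγ p.1))
    have hc : Continuous fun p : unitInterval × E => γ p.1 := by fun_prop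
    have hi : Continuous fun p : unitInterval × E => inner ℝ (γ p.1) p.2 := by fun_prop
    exact continuous_snd.sub (((continuous_const.mul (hi.div (hc.norm.pow 2) this))).smul hc)⟩
  obtain ⟨h1, h2, h3⟩ := mem_cycles.1 hz
  obtain ⟨w, hw, h⟩ := exists_bdry_eq_of_homotopy F (V := {0}ᶜ)
    (fun s x hx => mapsTo_isometryMap (hyperplaneReflection (γ s)) hx) h1 h3
  have e1 : F.comp (atHeight 1) = isometryMap (hyperplaneReflection u) := by
    ext x
    change hyperplaneReflection (γ 1) x = hyperplaneReflection u x
    simp [γ]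
  have e0 : F.comp (atHeight 0) = isometryMap (hyperplaneReflection v) := by
    ext x
    change hyperplaneReflection (γ 0) x = hyperplaneReflection v x
    simp [γ]
  rw [e1, e0] at h
  rw [← h]
  refine bdry_mem_boundaries hw ?_
  rw [h]
  exact Submodule.sub_mem _ (mem_cycles.1 (push_isometryMap_mem_cycles _ hz)).2.1
    (mem_cycles.1 (push_isometryMap_mem_cycles _ hz)).2.1

lemma push_hyperplaneReflection_sub_mem {u v : E} (hu : u ≠ 0) (hv : v ≠ 0) {z : SingChain E}
    (hz : z ∈ cycles ({0}ᶜ : Set E) k) :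
    push (isometryMap (hyperplaneReflection u)) z - push (isometryMap (hyperplaneReflection v)) z ∈
      boundaries ({0}ᶜ : Set E) k := by
  rcases le_total 0 (inner ℝ v u) with h | h
  · exact push_hyperplaneReflection_sub_mem_of_inner_nonneg hu hv h hz
  · rw [← hyperplaneReflection_neg u]
    exact push_hyperplaneReflection_sub_mem_of_inner_nonneg (neg_ne_zero.2 hu) hv
      (by rw [inner_neg_right]; linarith) hz

lemma hyperplaneReflection_zero : hyperplaneReflection (0 : E) = 1 := by
  ext x
  rw [hyperplaneReflection_apply, smul_zero, sub_zero]
  rfl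

variable [FiniteDimensional ℝ E]

lemma det_hyperplaneReflection {v : E} (hv : v ≠ 0) :
    LinearMap.det ((hyperplaneReflection v).toLinearEquiv : E →ₗ[ℝ] E) = -1 := by
  refine (Submodule.det_reflection _).trans ?_
  rw [Submodule.orthogonal_orthogonal, finrank_span_singleton hv, pow_one]

lemma push_prod_sub_mem (l : List E) {z : SingChain E} (hz : z ∈ cycles ({0}ᶜ : Set E) k) :
    (LinearMap.det (((l.map hyperplaneReflection).prod).toLinearEquiv : E →ₗ[ℝ] E) = 1 ∧
      push (isometryMap (l.map hyperplaneReflection).prod) z - z ∈ boundaries ({0}ᶜ : Set E) k) ∨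
    (LinearMap.det (((l.map hyperplaneReflection).prod).toLinearEquiv : E →ₗ[ℝ] E) = -1 ∧
      ∀ e : E, e ≠ 0 → push (isometryMap (l.map hyperplaneReflection).prod) z -
        push (isometryMap (hyperplaneReflection e)) z ∈ boundaries ({0}ᶜ : Set E) k) := by
  induction l with
  | nil =>
    refine Or.inl ⟨LinearMap.det_id, ?_⟩
    rw [List.map_nil, List.prod_nil, push_isometryMap_one, sub_self]
    exact Submodule.zero_mem _
  | cons v l ih =>
    rw [List.map_cons, List.prod_cons]
    rcases eq_or_ne v 0 with rfl | hv
    · rwa [hyperplaneReflection_zero, one_mul]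
    set p := (l.map hyperplaneReflection).prod
    have hdet : LinearMap.det ((hyperplaneReflection v * p).toLinearEquiv : E →ₗ[ℝ] E) =
        - LinearMap.det (p.toLinearEquiv : E →ₗ[ℝ] E) := by
      rw [← neg_one_mul, ← det_hyperplaneReflection hv, ← LinearMap.det_comp]
      rfl
    rw [hdet, push_isometryMap_mul]
    rcases ih with ⟨h1, h2⟩ | ⟨h1, h2⟩
    · refine Or.inr ⟨by rw [h1], fun e he => ?_⟩
      have h3 := push_isometryMap_mem_boundaries (hyperplaneReflection v) h2
      rw [map_sub] at h3
      simpa using Submodule.add_mem _ h3 (push_hyperplaneReflection_sub_mem hv he hz)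
    · refine Or.inl ⟨by rw [h1, neg_neg], ?_⟩
      have h3 := push_isometryMap_mem_boundaries (hyperplaneReflection v) (h2 v hv)
      rwa [map_sub, ← push_isometryMap_mul _ (hyperplaneReflection v) z,
        hyperplaneReflection_mul_self,
        push_isometryMap_one] at h3

lemma push_sub_mem_boundaries_of_det_eq_one (g : E ≃ₗᵢ[ℝ] E)
    (hg : LinearMap.det (g.toLinearEquiv : E →ₗ[ℝ] E) = 1) {z : SingChain E}
    (hz : z ∈ cycles ({0}ᶜ : Set E) k) :
    push (isometryMap g) z - z ∈ boundaries ({0}ᶜ : Set E) k := by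
  obtain ⟨l, -, rfl⟩ := g.reflections_generate_dim
  rcases push_prod_sub_mem l hz with ⟨-, h⟩ | ⟨h, -⟩
  · exact h
  · rw [hg] at h
    norm_num at h

/-- The orbits of nonzero vectors under a finite group of rotations have the homology of a
sphere. -/
lemma isHomologySphere_image_compl_zero {n : ℕ} {Y : Type*} [TopologicalSpace Y]
    {G : Subgroup (EuclideanSpace ℝ (Fin n) ≃ₗᵢ[ℝ] EuclideanSpace ℝ (Fin n))} [Finite G]
    (hdet : ∀ g ∈ G, LinearMap.det (g.toLinearEquiv :
      EuclideanSpace ℝ (Fin n) →ₗ[ℝ] EuclideanSpace ℝ (Fin n)) = 1)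
    {q : C(EuclideanSpace ℝ (Fin n), Y)} (hq : IsOrbitMap G q) :
    IsHomologySphere (q '' {0}ᶜ) n :=
  (isHomologySphere_compl_zero n).congr fun k =>
    (coneAcyclic_compl_zero hq).nonempty_homology_equiv
      (fun g _ hx => mapsTo_isometryMap g.1 hx) k fun g _ hz =>
        push_sub_mem_boundaries_of_det_eq_one g.1 (hdet g.1 g.2) hz

end Rotation

end SingChain

/-! ### The collapsed orbit space of the disk -/

namespace SingChain

lemma acyclic_of_isQuotientMap {X Y : Type*} [TopologicalSpace X] [TopologicalSpace Y] {f : X → Y}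
    (hf : Topology.IsQuotientMap f) {U : Set Y} (hU : IsOpen U) (h : unitInterval → X → Y)
    (hc : ContinuousOn (fun p : unitInterval × X => h p.1 p.2) (Set.univ ×ˢ (f ⁻¹' U)))
    (hfib : ∀ s x x', x ∈ f ⁻¹' U → f x = f x' → h s x = h s x')
    (h0 : ∀ x ∈ f ⁻¹' U, h 0 x = f x) (hm : ∀ s, ∀ x ∈ f ⁻¹' U, h s x ∈ U) {p : Y} (hp : p ∈ U)
    (h1 : ∀ x ∈ f ⁻¹' U, h 1 x = p) : Acyclic U := by
  have hs : ∀ y, f (Function.surjInv hf.surjective y) = y := Function.surjInv_eq hf.surjective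
  have hsU : ∀ y ∈ U, Function.surjInv hf.surjective y ∈ f ⁻¹' U := fun y hy => by
    rwa [Set.mem_preimage, hs]
  let L : LocalContraction U :=
    { H := fun s y => h s (Function.surjInv hf.surjective y)
      continuousOn := by
        have hc' : Continuous fun p : unitInterval × U =>
            h p.1 (Function.surjInv hf.surjective p.2.1) := by
          refine (hf.restrictPreimage_isOpen hU).continuous_lift_prod_right ?_
          have : (fun p : unitInterval × (f ⁻¹' U) => h p.1 (Function.surjInv hf.surjective
              (U.restrictPreimage f p.2).1)) = fun p => h p.1 p.2.1 :=
            funext fun p => (hfib _ _ _ p.2.2 (hs _).symm).symm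
          rw [this]
          exact hc.comp_continuous (f := fun p : unitInterval × (f ⁻¹' U) => (p.1, p.2.1))
            (by fun_prop) fun p => ⟨trivial, p.2.2⟩
        have ho : Topology.IsOpenEmbedding
            (Prod.map id Subtype.val : unitInterval × U → unitInterval × Y) :=
          Topology.IsOpenEmbedding.id.prodMap hU.isOpenEmbedding_subtypeVal
        rintro ⟨s, y⟩ ⟨-, hy⟩
        refine ContinuousAt.continuousWithinAt ?_
        exact (ho.continuousAt_iff (x := (s, ⟨y, hy⟩))).1 hc'.continuousAt
      zero := fun y hy => by rw [h0 _ (hsU y hy), hs]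
      mem := fun s y hy => hm s _ (hsU y hy)
      locallyConstant := fun y hy => by
        filter_upwards [self_mem_nhdsWithin] with y' hy'
        rw [h1 _ (hsU y hy), h1 _ (hsU y' hy')] }
  exact L.acyclic hp fun y hy => h1 _ (hsU y hy)

section Disk

open OpenPartialHomeomorph Topology

variable {n : ℕ} {G : Subgroup (EuclideanSpace ℝ (Fin n) ≃ₗᵢ[ℝ] EuclideanSpace ℝ (Fin n))}

/-- The projection of the disk to its collapsed orbit space. -/
def collapse (G : Subgroup (EuclideanSpace ℝ (Fin n) ≃ₗᵢ[ℝ] EuclideanSpace ℝ (Fin n)))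
    (x : Metric.closedBall (0 : EuclideanSpace ℝ (Fin n)) 1) : Quotient (collapseSetoid n G) :=
  Quotient.mk _ (Quotient.mk _ x)

lemma isQuotientMap_collapse : IsQuotientMap (collapse G) :=
  isQuotientMap_quotient_mk'.comp isQuotientMap_quotient_mk'

lemma mk_mem_sphereOrbitImage {x : Metric.closedBall (0 : EuclideanSpace ℝ (Fin n)) 1} :
    Quotient.mk (diskOrbitSetoid n G) x ∈ sphereOrbitImage n G ↔ ‖x.1‖ = 1 := by
  constructor
  · rintro ⟨y, hy, h⟩
    obtain ⟨g, -, hg⟩ := Quotient.exact h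
    exact (g.norm_map _).symm.trans ((congrArg norm hg).trans hy)
  · exact fun h => ⟨x, h, rfl⟩

lemma collapse_eq_iff {x y : Metric.closedBall (0 : EuclideanSpace ℝ (Fin n)) 1} :
    collapse G x = collapse G y ↔ (∃ g : G, g.1 x.1 = y.1) ∨ ‖x.1‖ = 1 ∧ ‖y.1‖ = 1 := by
  rw [collapse, collapse, Quotient.eq]
  change _ ∨ _ ↔ _
  rw [mk_mem_sphereOrbitImage, mk_mem_sphereOrbitImage, Quotient.eq]
  exact or_congr_left ⟨fun ⟨g, hg, h⟩ => ⟨⟨g, hg⟩, h⟩, fun ⟨g, h⟩ => ⟨g.1, g.2, h⟩⟩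

/-- The inclusion of Euclidean space as the interior of the disk. -/
def interiorMap (n : ℕ) : C(EuclideanSpace ℝ (Fin n),
    Metric.closedBall (0 : EuclideanSpace ℝ (Fin n)) 1) where
  toFun x := ⟨univUnitBall x, Metric.ball_subset_closedBall
    (univUnitBall.map_source (Set.mem_univ x))⟩
  continuous_toFun := Continuous.subtype_mk
    (continuousOn_univ.1 univUnitBall.continuousOn) _

lemma norm_interiorMap_lt (x : EuclideanSpace ℝ (Fin n)) : ‖(interiorMap n x).1‖ < 1 :=
  mem_ball_zero_iff.1 (univUnitBall.map_source (Set.mem_univ x))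

lemma interiorMap_injective : Function.Injective (interiorMap n) := fun x y h =>
  univUnitBall.injOn (Set.mem_univ x) (Set.mem_univ y) (congrArg Subtype.val h)

lemma interiorMap_act (g : G) (x : EuclideanSpace ℝ (Fin n)) :
    (interiorMap n (g.1 x)).1 = g.1 (interiorMap n x).1 := by
  change univUnitBall (g.1 x) = g.1 (univUnitBall x)
  rw [univUnitBall_apply, univUnitBall_apply, map_smul, LinearIsometryEquiv.norm_map]

lemma interiorMap_zero : (interiorMap n 0).1 = 0 := univUnitBall_apply_zero

/-- The projection of Euclidean space to the interior of the collapsed orbit space. -/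
def interiorCollapse (G : Subgroup (EuclideanSpace ℝ (Fin n) ≃ₗᵢ[ℝ] EuclideanSpace ℝ (Fin n))) :
    C(EuclideanSpace ℝ (Fin n), Quotient (collapseSetoid n G)) :=
  ⟨fun x => collapse G (interiorMap n x),
    isQuotientMap_collapse.continuous.comp (interiorMap n).continuous⟩

lemma collapse_eq_interiorCollapse_iff {x : Metric.closedBall (0 : EuclideanSpace ℝ (Fin n)) 1}
    {y : EuclideanSpace ℝ (Fin n)} :
    collapse G x = interiorCollapse G y ↔ ∃ g : G, g.1 x.1 = (interiorMap n y).1 :=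
  collapse_eq_iff.trans (or_iff_left fun h => (norm_interiorMap_lt y).ne h.2)

lemma isOrbitMap_interiorCollapse : IsOrbitMap G (interiorCollapse G) where
  isOpenMap W hW := by
    rw [← isQuotientMap_collapse.isOpen_preimage]
    have : collapse G ⁻¹' (interiorCollapse G '' W) =
        ⋃ g : G, (fun x => g.1 x.1) ⁻¹' (univUnitBall '' W) := by
      ext x
      simp only [Set.mem_preimage, Set.mem_iUnion, Set.mem_image]
      rw [exists_comm]
      refine exists_congr fun y => ?_
      rw [exists_and_left]
      refine and_congr_right fun _ => ?_
      rw [eq_comm, collapse_eq_interiorCollapse_iff]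
      exact exists_congr fun g => eq_comm
    rw [this]
    refine isOpen_iUnion fun g => IsOpen.preimage ?_ ?_
    · exact g.1.continuous.comp continuous_subtype_val
    · exact univUnitBall.isOpen_image_of_subset_source hW (Set.subset_univ W)
  eq_iff x y := by
    refine collapse_eq_interiorCollapse_iff.trans (exists_congr fun g => ?_)
    rw [← interiorMap_act]
    exact ⟨fun h => interiorMap_injective (Subtype.ext h), fun h => by rw [h]⟩

variable (G) in
/-- The collapsed orbit space without the class of the origin. -/
def outerPart : Set (Quotient (collapseSetoid n G)) := {interiorCollapse G 0}ᶜ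

lemma collapse_mem_outerPart {x : Metric.closedBall (0 : EuclideanSpace ℝ (Fin n)) 1} :
    collapse G x ∈ outerPart G ↔ x.1 ≠ 0 := by
  rw [outerPart, Set.mem_compl_singleton_iff, not_iff_not, collapse_eq_interiorCollapse_iff,
    interiorMap_zero]
  simp only [LinearIsometryEquiv.map_eq_zero_iff, exists_const]

lemma isOpen_outerPart : IsOpen (outerPart G) := by
  rw [← isQuotientMap_collapse.isOpen_preimage]
  have : collapse G ⁻¹' outerPart G = {x | x.1 ≠ 0} := by
    ext x; exact collapse_mem_outerPart
  rw [this]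
  exact isOpen_ne_fun continuous_subtype_val continuous_const

/-- The radial deformation of the complement of the origin in the disk to the boundary. -/
def radial (s : unitInterval) (x : Metric.closedBall (0 : EuclideanSpace ℝ (Fin n)) 1) :
    Metric.closedBall (0 : EuclideanSpace ℝ (Fin n)) 1 :=
  ⟨(1 - (s : ℝ)) • x.1 + ((s : ℝ) * ‖x.1‖⁻¹) • x.1, by
    rw [← add_smul, mem_closedBall_zero_iff, norm_smul, Real.norm_of_nonneg
      (add_nonneg (sub_nonneg.2 s.2.2) (mul_nonneg s.2.1 (by positivity))), add_mul, mul_assoc]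
    have h1 := mem_closedBall_zero_iff.1 x.2
    have h2 : ‖x.1‖⁻¹ * ‖x.1‖ ≤ 1 := inv_mul_le_one
    nlinarith [s.2.1, s.2.2]⟩

lemma radial_ne_zero (s : unitInterval) {x : Metric.closedBall (0 : EuclideanSpace ℝ (Fin n)) 1}
    (hx : x.1 ≠ 0) : (radial s x).1 ≠ 0 := by
  change (1 - (s : ℝ)) • x.1 + ((s : ℝ) * ‖x.1‖⁻¹) • x.1 ≠ 0
  rw [← add_smul]
  refine smul_ne_zero (ne_of_gt ?_) hx
  have h : 0 < ‖x.1‖⁻¹ := inv_pos.2 (norm_pos_iff.2 hx)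
  rcases (sub_nonneg.2 s.2.2).eq_or_lt with hs | hs
  · rw [← hs, show (s : ℝ) = 1 by linarith, zero_add, one_mul]
    exact h
  · exact add_pos_of_pos_of_nonneg hs (mul_nonneg s.2.1 h.le)

lemma radial_one {x : Metric.closedBall (0 : EuclideanSpace ℝ (Fin n)) 1} (hx : x.1 ≠ 0) :
    ‖(radial 1 x).1‖ = 1 := by
  change ‖(1 - ((1 : unitInterval) : ℝ)) • x.1 + (((1 : unitInterval) : ℝ) * ‖x.1‖⁻¹) • x.1‖ = 1
  rw [Set.Icc.coe_one, sub_self, zero_smul, zero_add, one_mul, norm_smul, norm_inv, norm_norm,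
    inv_mul_cancel₀ (norm_ne_zero_iff.2 hx)]

lemma radial_zero (x : Metric.closedBall (0 : EuclideanSpace ℝ (Fin n)) 1) : radial 0 x = x :=
  Subtype.ext (by simp [radial])

lemma radial_of_norm_eq_one (s : unitInterval)
    {x : Metric.closedBall (0 : EuclideanSpace ℝ (Fin n)) 1} (hx : ‖x.1‖ = 1) : radial s x = x :=
  Subtype.ext (by simp [radial, hx, ← add_smul])

lemma acyclic_outerPart (hn : n ≠ 0) : Acyclic (outerPart G) := by
  have : Nonempty (Fin n) := ⟨⟨0, Nat.pos_of_ne_zero hn⟩⟩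
  obtain ⟨e, he⟩ := exists_norm_eq (EuclideanSpace ℝ (Fin n)) zero_le_one
  let e' : Metric.closedBall (0 : EuclideanSpace ℝ (Fin n)) 1 :=
    ⟨e, mem_closedBall_zero_iff.2 he.le⟩
  have he0 : e'.1 ≠ 0 := norm_ne_zero_iff.1 (by rw [show ‖e'.1‖ = 1 from he]; exact one_ne_zero)
  refine acyclic_of_isQuotientMap isQuotientMap_collapse isOpen_outerPart
    (fun s x => collapse G (radial s x)) ?_ ?_ ?_ ?_ (p := collapse G e')
    (collapse_mem_outerPart.2 he0) ?_
  · refine isQuotientMap_collapse.continuous.comp_continuousOn ?_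
    rw [IsEmbedding.subtypeVal.isInducing.continuousOn_iff]
    change ContinuousOn
      (fun p : unitInterval × Metric.closedBall (0 : EuclideanSpace ℝ (Fin n)) 1 =>
      (1 - (p.1 : ℝ)) • p.2.1 + ((p.1 : ℝ) * ‖p.2.1‖⁻¹) • p.2.1) _
    have h1 : ContinuousOn (fun p : unitInterval ×
        Metric.closedBall (0 : EuclideanSpace ℝ (Fin n)) 1 => ‖p.2.1‖⁻¹)
        (Set.univ ×ˢ (collapse G ⁻¹' outerPart G)) :=
      ContinuousOn.inv₀ (by fun_prop) fun p hp => norm_ne_zero_iff.2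
        (collapse_mem_outerPart.1 hp.2)
    fun_prop
  · rintro s x x' - h
    rcases collapse_eq_iff.1 h with ⟨g, hg⟩ | ⟨h1, h2⟩
    · refine collapse_eq_iff.2 (Or.inl ⟨g, ?_⟩)
      simp only [radial, map_add, map_smul, ← hg, LinearIsometryEquiv.norm_map]
    · rw [radial_of_norm_eq_one s h1, radial_of_norm_eq_one s h2, h]
  · intro x _
    exact congrArg (collapse G) (radial_zero x)
  · intro s x hx
    exact collapse_mem_outerPart.2 (radial_ne_zero s (collapse_mem_outerPart.1 hx))
  · intro x hx
    exact collapse_eq_iff.2 (Or.inr ⟨radial_one (collapse_mem_outerPart.1 hx), he⟩)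

/-- The whole space as a single convex part. -/
def _root_.ConvexDecomposition.univ {E : Type*} [NormedAddCommGroup E] [NormedSpace ℝ E]
    (G : Subgroup (E ≃ₗᵢ[ℝ] E)) : ConvexDecomposition G (Set.univ : Set E) where
  part _ := Set.univ
  isOpen := isOpen_univ
  act_mem _ _ _ := trivial
  mem_part _ _ := trivial
  convex_part _ _ := convex_univ
  isOpen_part _ _ := isOpen_univ
  part_subset _ _ := subset_rfl
  part_eq _ _ _ _ := rfl
  part_act g _ _ := (Set.image_univ_of_surjective g.1.surjective).symm

lemma acyclic_image_univ {E Y : Type*} [NormedAddCommGroup E] [NormedSpace ℝ E]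
    [TopologicalSpace Y] {G : Subgroup (E ≃ₗᵢ[ℝ] E)} [Finite G] {q : C(E, Y)}
    (hq : IsOrbitMap G q) : Acyclic (q '' Set.univ) := by
  have := Fintype.ofFinite G
  let D := ConvexDecomposition.univ G
  refine (D.contractionImage hq).acyclic (p := q (D.center 0)) ⟨_, trivial, rfl⟩ fun y _ => ?_
  rw [D.contractionImage_one hq, D.center_eq (x := 0) trivial trivial]

lemma isHomologySphere_collapsed_disk (hn : n ≠ 0) [Finite G]
    (hdet : ∀ g ∈ G, LinearMap.det (g.toLinearEquiv :
      EuclideanSpace ℝ (Fin n) →ₗ[ℝ] EuclideanSpace ℝ (Fin n)) = 1) :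
    IsHomologySphere (Set.univ : Set (Quotient (collapseSetoid n G))) (n + 1) := by
  have hq := isOrbitMap_interiorCollapse (G := G)
  have h := isHomologySphere_image_compl_zero hdet hq
  have hi : interiorCollapse G '' {0}ᶜ = outerPart G ∩ interiorCollapse G '' Set.univ := by
    ext y
    constructor
    · rintro ⟨x, hx, rfl⟩
      refine ⟨fun h => hx ?_, x, trivial, rfl⟩
      obtain ⟨g, hg⟩ := (hq.eq_iff _ _).1 h
      exact (g.1.map_eq_zero_iff).1 hg
    · rintro ⟨h, x, -, rfl⟩
      exact ⟨x, fun hx => h (congrArg (interiorCollapse G) hx), rfl⟩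
  have hu : Set.univ = outerPart G ∪ interiorCollapse G '' Set.univ := by
    refine (Set.eq_univ_of_forall fun y => ?_).symm
    by_cases h : y = interiorCollapse G 0
    · exact Or.inr ⟨0, trivial, h.symm⟩
    · exact Or.inl h
  rw [hi] at h
  rw [hu]
  exact IsHomologySphere.suspension isOpen_outerPart (hq.isOpenMap _ isOpen_univ)
    (acyclic_outerPart hn) (acyclic_image_univ hq)
    ⟨interiorCollapse G 0, Or.inr ⟨0, trivial, rfl⟩⟩ h

end Disk

end SingChain

/-! ### Comparison with the singular chain complex -/

namespace SingChain

section Comparison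

variable {X : TopCat}

/-- The singular simplices of the singular simplicial set, as simplices with `p + 1` vertices. -/
def ofSSet (p : ℕ) (s : (TopCat.toSSet.obj X).obj (.op (.mk p))) : SingSimplex X :=
  ⟨p + 1, TopCat.toSSetObjEquiv X _ s⟩

lemma ofSSet_injective (p : ℕ) : Function.Injective (ofSSet (X := X) p) := fun _ _ h =>
  (TopCat.toSSetObjEquiv X _).injective (eq_of_heq (Sigma.mk.inj h).2)

/-- The inclusion of the singular chain complex into all chains. -/
def toChain (p : ℕ) : (singularChainComplexQ X).X p →ₗ[ℚ] SingChain X :=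
  Finsupp.lmapDomain ℚ ℚ (ofSSet p)

lemma toChain_single (p : ℕ) (s : (TopCat.toSSet.obj X).obj (.op (.mk p))) :
    toChain (X := X) p (Finsupp.single s 1 : _ →₀ ℚ) = Finsupp.single (ofSSet p s) 1 :=
  Finsupp.mapDomain_single

lemma toChain_injective (p : ℕ) : Function.Injective (toChain (X := X) p) :=
  Finsupp.mapDomain_injective (ofSSet_injective p)

lemma range_toChain (p : ℕ) : LinearMap.range (toChain (X := X) p) = ofDegree X (p + 1) := by
  have h : LinearMap.range (toChain (X := X) p) = _ := Finsupp.range_lmapDomain (R := ℚ) (ofSSet p)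
  rw [h, ofDegree, Finsupp.supported_eq_span_single]
  congr 1
  ext c
  constructor
  · rintro ⟨s, rfl⟩
    exact ⟨ofSSet p s, rfl, rfl⟩
  · rintro ⟨⟨k, σ⟩, rfl, rfl⟩
    exact ⟨(TopCat.toSSetObjEquiv X (.op (.mk p))).symm σ,
      congrArg (Finsupp.single · 1) (congrArg (Sigma.mk _) (Equiv.apply_symm_apply _ σ))⟩

lemma toChain_mem_ofDegree {p : ℕ} (c : (singularChainComplexQ X).X p) :
    toChain p c ∈ ofDegree X (p + 1) :=
  range_toChain (X := X) p ▸ LinearMap.mem_range_self _ c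

lemma exists_toChain_eq {p : ℕ} {c : SingChain X} (hc : c ∈ ofDegree X (p + 1)) :
    ∃ b, toChain (X := X) p b = c := by
  rwa [← range_toChain] at hc

lemma d_single (p : ℕ) (s : (TopCat.toSSet.obj X).obj (.op (.mk (p + 1)))) :
    ((singularChainComplexQ X).d (p + 1) p).hom (Finsupp.single s 1 : _ →₀ ℚ) =
      ∑ i : Fin (p + 2), (-1 : ℤ) ^ (i : ℕ) •
        (Finsupp.single ((TopCat.toSSet.obj X).δ i s) 1 : _ →₀ ℚ) := by
  have h : (singularChainComplexQ X).d (p + 1) p = _ :=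
    AlgebraicTopology.AlternatingFaceMapComplex.obj_d_eq _ p
  rw [h]
  erw [ModuleCat.hom_sum, LinearMap.sum_apply]
  refine Finset.sum_congr rfl fun i _ => ?_
  erw [ModuleCat.hom_zsmul, LinearMap.smul_apply]
  congr 1
  exact Finsupp.mapDomain_single

lemma bdry_toChain (p : ℕ) (c : (singularChainComplexQ X).X (p + 1)) :
    bdry (toChain (p + 1) c) = toChain p (((singularChainComplexQ X).d (p + 1) p).hom c) := by
  suffices bdry ∘ₗ toChain (p + 1) = toChain p ∘ₗ ((singularChainComplexQ X).d (p + 1) p).hom from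
    LinearMap.congr_fun this c
  refine Finsupp.lhom_ext' fun s => LinearMap.ext_ring ?_
  change bdry (toChain (p + 1) (Finsupp.single s 1 : _ →₀ ℚ)) =
    toChain p (((singularChainComplexQ X).d (p + 1) p).hom (Finsupp.single s 1 : _ →₀ ℚ))
  rw [d_single, toChain_single, ofSSet, bdry_single_succ]
  refine Eq.trans ?_ (map_sum (toChain p) _ _).symm
  refine Finset.sum_congr rfl fun i _ => ?_
  refine Eq.trans ?_ (map_zsmul (toChain p) _ _).symm
  rw [toChain_single, ← Int.cast_smul_eq_zsmul ℚ]
  push_cast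
  rfl

lemma nonempty_homology_equiv_of_sc (K : ChainComplex (ModuleCat ℚ) ℕ) {i j k : ℕ}
    (hi : (ComplexShape.down ℕ).prev j = i) (hk : (ComplexShape.down ℕ).next j = k)
    {M : Type*} [AddCommGroup M] [Module ℚ M] (B : Submodule ℚ M)
    (g : LinearMap.ker (K.d j k).hom →ₗ[ℚ] M) (hg : Function.Surjective g)
    (h : ∀ m, (∃ w, (K.d i j).hom w = m.1) ↔ g m ∈ B) :
    Nonempty (K.homology j ≃ₗ[ℚ] (M ⧸ B)) := by
  let e := (K.homologyIsoSc' i j k hi hk ≪≫ (K.sc' i j k).moduleCatHomologyIso).toLinearEquiv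
  obtain ⟨e'⟩ := nonempty_quotient_equiv LinearMap.id g
    (LinearMap.range (K.sc' i j k).moduleCatToCycles) B (fun z => ⟨z, by simp⟩)
    (fun z => by
      obtain ⟨m, rfl⟩ := hg z
      exact ⟨m, by simp⟩)
    (fun m => by
      rw [← h]
      exact ⟨fun ⟨w, hw⟩ => ⟨w, congrArg Subtype.val hw⟩, fun ⟨w, hw⟩ => ⟨w, Subtype.ext hw⟩⟩)
  exact ⟨e.trans e'⟩

lemma nonempty_singularHomologyQ_succ_equiv (p : ℕ) :
    Nonempty (singularHomologyQ X (p + 1) ≃ₗ[ℚ] Homology (Set.univ : Set X) (p + 2)) := by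
  refine nonempty_homology_equiv_of_sc (singularChainComplexQ X) (i := p + 2) (k := p) (by simp)
    (by simp) _ ((toChain (p + 1)).restrict fun c hc => ?_) ?_ ?_
  · refine mem_cycles.2 ⟨mem_within_univ _, toChain_mem_ofDegree c, ?_⟩
    rw [bdry_toChain, LinearMap.mem_ker.1 hc, map_zero]
  · rintro ⟨z, hz⟩
    obtain ⟨-, hz, h0⟩ := mem_cycles.1 hz
    obtain ⟨c, rfl⟩ := exists_toChain_eq hz
    refine ⟨⟨c, toChain_injective p ?_⟩, rfl⟩
    rw [← bdry_toChain, h0, map_zero]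
  · rintro ⟨c, hc⟩
    change _ ↔ toChain (p + 1) c ∈ boundaries Set.univ (p + 2)
    constructor
    · rintro ⟨w, rfl⟩
      rw [← bdry_toChain]
      refine bdry_mem_boundaries (mem_within_univ _) ?_
      rw [bdry_toChain]
      exact toChain_mem_ofDegree _
    · intro h
      obtain ⟨w, -, hw, hb⟩ := exists_of_mem_boundaries h
      obtain ⟨w, rfl⟩ := exists_toChain_eq hw
      exact ⟨w, toChain_injective _ ((bdry_toChain _ _).symm.trans hb)⟩

lemma nonempty_singularHomologyQ_zero_equiv [Nonempty X]
    (h : Subsingleton (Homology (Set.univ : Set X) 1)) :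
    Nonempty (singularHomologyQ X 0 ≃ₗ[ℚ] ℚ) := by
  have hd : (singularChainComplexQ X).d 0 0 = 0 := (singularChainComplexQ X).shape _ _ (by simp)
  let g := emptyCoeff ∘ₗ bdry ∘ₗ toChain (X := X) 0
  refine (nonempty_homology_equiv_of_sc (singularChainComplexQ X) (i := 1) (k := 0) (by simp)
    (by simp) (⊥ : Submodule ℚ ℚ) (g ∘ₗ Submodule.subtype _) ?_ ?_).map
      fun e => e.trans (Submodule.quotEquivOfEqBot _ rfl)
  · intro r
    obtain ⟨x⟩ := ‹Nonempty X›
    obtain ⟨c, hc⟩ := exists_toChain_eq (X := X) (p := 0) (c := r • point x)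
      (Submodule.smul_mem _ _ (Finsupp.single_mem_supported ℚ _ rfl))
    refine ⟨⟨c, by rw [hd]; rfl⟩, ?_⟩
    change emptyCoeff (bdry (toChain 0 c)) = r
    rw [hc, map_smul, map_smul, bdry_point, emptyCoeff_empty, smul_eq_mul, mul_one]
  · rintro ⟨c, hc⟩
    change _ ↔ emptyCoeff (bdry (toChain 0 c)) ∈ _
    rw [Submodule.mem_bot]
    constructor
    · rintro ⟨w, rfl⟩
      rw [← bdry_toChain, bdry_bdry, map_zero]
    · intro h0
      have h1 : bdry (toChain 0 c) = 0 := by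
        rw [eq_smul_empty (bdry_mem_ofDegree (toChain_mem_ofDegree c)), h0, zero_smul]
      obtain ⟨w, -, hw, hb⟩ := exists_of_mem_boundaries (mem_boundaries_of_subsingleton h
        (mem_cycles.2 ⟨mem_within_univ _, toChain_mem_ofDegree c, h1⟩))
      obtain ⟨w, rfl⟩ := exists_toChain_eq hw
      exact ⟨w, toChain_injective _ ((bdry_toChain _ _).symm.trans hb)⟩

end Comparison

end SingChain

/-- let `n ≥ 2` and let `G` be a finite group of orientation-preserving
orthogonal linear transformations of `ℝⁿ`.  Let `Y = (D^n/G)/(S^{n-1}/G)` be the quotient of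
the orbit space of the closed unit disk obtained by collapsing the orbit space of the
boundary sphere to a point.  Then `H_p(Y; ℚ) ≅ ℚ` for `p = 0` and `p = n`, and
`H_p(Y; ℚ) = 0` for all other `p`. -/
theorem homology_of_collapsed_disk_orbit_space
    (n : ℕ) (hn : 2 ≤ n)
    (G : Subgroup (EuclideanSpace ℝ (Fin n) ≃ₗᵢ[ℝ] EuclideanSpace ℝ (Fin n)))
    [Finite G]
    (hdet : ∀ g ∈ G,
      LinearMap.det (g.toLinearEquiv :
        EuclideanSpace ℝ (Fin n) →ₗ[ℝ] EuclideanSpace ℝ (Fin n)) = 1)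
    (p : ℕ) :
    (p = 0 ∨ p = n →
      Nonempty
        (singularHomologyQ (TopCat.of (Quotient (collapseSetoid n G))) p ≃ₗ[ℚ] ℚ)) ∧
    (p ≠ 0 → p ≠ n →
      Subsingleton
        (singularHomologyQ (TopCat.of (Quotient (collapseSetoid n G))) p)) := by
  obtain ⟨⟨e⟩, h⟩ := SingChain.isHomologySphere_collapsed_disk (by omega) hdet
  have : Nonempty (TopCat.of (Quotient (collapseSetoid n G))) :=
    ⟨SingChain.collapse G ⟨0, Metric.mem_closedBall_self zero_le_one⟩⟩
  obtain ⟨e₀⟩ := SingChain.nonempty_singularHomologyQ_zero_equiv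
    (X := TopCat.of (Quotient (collapseSetoid n G))) (h 1 (by omega))
  cases p with
  | zero => exact ⟨fun _ => ⟨e₀⟩, fun h0 => absurd rfl h0⟩
  | succ p =>
    obtain ⟨e'⟩ := SingChain.nonempty_singularHomologyQ_succ_equiv
      (X := TopCat.of (Quotient (collapseSetoid n G))) p
    refine ⟨fun hp => ?_, fun _ hp => ?_⟩
    · obtain rfl : p + 1 = n := hp.resolve_left p.succ_ne_zero
      exact ⟨e'.trans e⟩
    · have := h (p + 2) (by omega)
      exact e'.toEquiv.subsingleton
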